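/- arXiv:1704.05896 — 3 statements merged into one kernel-verified Lean document; each statement's English description precedes it below -/
import Mathlib

section
/- If the instance I' has a solution, then M contains a multicolored k-clique. -/
namespace MCC

/-- `k₀ = k + C(k,2)`. -/
def k0 (k : ℕ) : ℕ := k + Nat.choose k 2

/-- `K = k + 3·C(k,2)`, the cut budget. -/
def KK (k : ℕ) : ℕ := k + 3 * Nat.choose k 2

/-- `z = k₀² · n⁵`. -/
def z (k n : ℕ) : ℕ := (k0 k)^2 * n^5

/-- `b_j = k₀^{2j} · z` (`j` is 1-based). -/
def bb (k n j : ℕ) : ℕ := (k0 k)^(2*j) * z k n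

/-- `c_j = k₀^{2(k+j)} · z` (`j` is 1-based). -/
def cc (k n j : ℕ) : ℕ := (k0 k)^(2*(k+j)) * z k n

/-- `c_j^q = c_k · k₀^{2((j−1)k − j(j−1)/2 + q − j)}` (`j, q` are 1-based, `j < q`). -/
def cjq (k n j q : ℕ) : ℕ := cc k n k * (k0 k)^(2*((j-1)*k - j*(j-1)/2 + q - j))

/-- The number of vertices of each copy of the star `S_fix`: `c_{k−1}^k + K + 1`. -/
def fixSize (k n : ℕ) : ℕ := cjq k n (k-1) k + KK k + 1

/-- The number of vertices of the vertex-gadget star `S_{v_i^j}`: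
`c_j − (k−1)·b_j − (k−1)·x_i`, for the vertex `v = (j, i)`. -/
def vgSize (k n : ℕ) (x : Fin n → ℕ) (v : Fin k × Fin n) : ℕ :=
  cc k n (v.1.1 + 1) - (k-1) * bb k n (v.1.1 + 1) - (k-1) * x v.2

/-- The number of vertices of the star `S'_{v_i^j}`: `b_j + x_i`, for the vertex `v = (j, i)`. -/
def spSize (k n : ℕ) (x : Fin n → ℕ) (v : Fin k × Fin n) : ℕ := bb k n (v.1.1 + 1) + x v.2

/-- Index type for the edges of `M`: ordered pairs of adjacent vertices, with the endpoint of
smaller color first. Each edge of `M` appears exactly once (the coloring being proper). -/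
def EIdx (k n : ℕ) (M : SimpleGraph (Fin k × Fin n)) : Type :=
  {p : (Fin k × Fin n) × (Fin k × Fin n) // M.Adj p.1 p.2 ∧ p.1.1 < p.2.1}

/-- The number of vertices of the star `S_e` of the edge-gadget `T_e`: `c_j^q` for an edge `e`
between color classes `j < q`. -/
def seSize (k n : ℕ) {M : SimpleGraph (Fin k × Fin n)} (e : EIdx k n M) : ℕ :=
  cjq k n (e.1.1.1.1 + 1) (e.1.2.1.1 + 1)

/-- The vertex type of the tree `T` of the instance `I'`: the root `r` (the `Unit` summand);
for each vertex `v` of `M` the star `S_v` (root `none`, leaves `some _`); for each edge `e`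
of `M` the edge-gadget `T_e` consisting of the star `S_e` and the two stars `S'` attached to
its two endpoints; and `K+1` copies of the star `S_fix`. -/
abbrev VV (k n : ℕ) (x : Fin n → ℕ) (M : SimpleGraph (Fin k × Fin n)) : Type :=
  Unit ⊕
  (Σ v : Fin k × Fin n, Option (Fin (vgSize k n x v - 1))) ⊕
  (Σ e : EIdx k n M,
    (Option (Fin (seSize k n e - 1)) ⊕ Option (Fin (spSize k n x e.1.1 - 1)) ⊕
      Option (Fin (spSize k n x e.1.2 - 1)))) ⊕
  (Fin (KK k + 1) × Option (Fin (fixSize k n - 1)))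

/-- Classify a vertex of an edge-gadget: which of the three stars it belongs to
(`0` for `S_e`, `1` and `2` for the two `S'`-stars) and whether it is that star's root. -/
def code {A B C : Type} : (Option A ⊕ Option B ⊕ Option C) → ℕ × Bool
  | Sum.inl none => (0, true)
  | Sum.inl (some _) => (0, false)
  | Sum.inr (Sum.inl none) => (1, true)
  | Sum.inr (Sum.inl (some _)) => (1, false)
  | Sum.inr (Sum.inr none) => (2, true)
  | Sum.inr (Sum.inr (some _)) => (2, false)

/-- Adjacency inside an edge-gadget `T_e`: the root `r_e` of `S_e` is joined to the leaves of
`S_e` and to the roots of the two `S'`-stars, and the root of each `S'`-star is joined to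
its leaves. -/
def codeRel : ℕ × Bool → ℕ × Bool → Prop
  | (0, true), (0, false) => True
  | (0, true), (1, true) => True
  | (0, true), (2, true) => True
  | (1, true), (1, false) => True
  | (2, true), (2, false) => True
  | _, _ => False

/-- The (directed) edge relation of the tree `T` of the instance `I'`. -/
def relMCC (k n : ℕ) (x : Fin n → ℕ) (M : SimpleGraph (Fin k × Fin n)) :
    VV k n x M → VV k n x M → Prop
  | Sum.inl _, Sum.inr (Sum.inl ⟨_, d⟩) => d = none
  | Sum.inr (Sum.inl ⟨u, d⟩), Sum.inr (Sum.inl ⟨u', d'⟩) => u = u' ∧ d = none ∧ d' ≠ none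
  | Sum.inl _, Sum.inr (Sum.inr (Sum.inl ⟨_, d⟩)) => code d = (0, true)
  | Sum.inr (Sum.inr (Sum.inl ⟨e, d⟩)), Sum.inr (Sum.inr (Sum.inl ⟨e', d'⟩)) =>
      e = e' ∧ codeRel (code d) (code d')
  | Sum.inl _, Sum.inr (Sum.inr (Sum.inr (_, d))) => d = none
  | Sum.inr (Sum.inr (Sum.inr (c, d))), Sum.inr (Sum.inr (Sum.inr (c', d'))) =>
      c = c' ∧ d = none ∧ d' ≠ none
  | _, _ => False

/-- The tree `T` of the instance `I'`. -/
def TG (k n : ℕ) (x : Fin n → ℕ) (M : SimpleGraph (Fin k × Fin n)) : SimpleGraph (VV k n x M) :=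
  SimpleGraph.fromRel (relMCC k n x M)

/-- The root `r` of `T`. -/
def rootT (k n : ℕ) (x : Fin n → ℕ) (M : SimpleGraph (Fin k × Fin n)) : VV k n x M :=
  Sum.inl ()

/-- The root `r_{v_i^j}` of the vertex-gadget star `S_{v_i^j}`. -/
def vgRoot (k n : ℕ) (x : Fin n → ℕ) (M : SimpleGraph (Fin k × Fin n)) (v : Fin k × Fin n) :
    VV k n x M :=
  Sum.inr (Sum.inl ⟨v, none⟩)

/-- The root `r_e` of the star `S_e` of the edge-gadget `T_e`. -/
def seRoot (k n : ℕ) (x : Fin n → ℕ) {M : SimpleGraph (Fin k × Fin n)} (e : EIdx k n M) :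
    VV k n x M :=
  Sum.inr (Sum.inr (Sum.inl ⟨e, Sum.inl none⟩))

/-- The root `r'_{v_i^j}` of the star `S'` of the lower-colored endpoint of `e`. -/
def sp1Root (k n : ℕ) (x : Fin n → ℕ) {M : SimpleGraph (Fin k × Fin n)} (e : EIdx k n M) :
    VV k n x M :=
  Sum.inr (Sum.inr (Sum.inl ⟨e, Sum.inr (Sum.inl none)⟩))

/-- The root `r'_{v_p^q}` of the star `S'` of the higher-colored endpoint of `e`. -/
def sp2Root (k n : ℕ) (x : Fin n → ℕ) {M : SimpleGraph (Fin k × Fin n)} (e : EIdx k n M) :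
    VV k n x M :=
  Sum.inr (Sum.inr (Sum.inl ⟨e, Sum.inr (Sum.inr none)⟩))

/-- The vertex set of the vertex-gadget star `S_v`. -/
def vgSet (k n : ℕ) (x : Fin n → ℕ) (M : SimpleGraph (Fin k × Fin n)) (v : Fin k × Fin n) :
    Set (VV k n x M) :=
  {w | ∃ d, w = Sum.inr (Sum.inl ⟨v, d⟩)}

/-- The vertex set of the star `S_e` of the edge-gadget `T_e`. -/
def SeSet (k n : ℕ) (x : Fin n → ℕ) {M : SimpleGraph (Fin k × Fin n)} (e : EIdx k n M) :
    Set (VV k n x M) :=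
  {w | ∃ d, w = Sum.inr (Sum.inr (Sum.inl ⟨e, Sum.inl d⟩))}

/-- The groups of the instance `I'`: the groups `G_1, …, G_k`, the groups `G_j^q` for
`1 ≤ j < q ≤ k`, and the group `G_rest`. -/
abbrev Grp (k : ℕ) : Type := Fin k ⊕ {pq : Fin k × Fin k // pq.1 < pq.2} ⊕ Unit

/-- The group `G_j`. -/
def gCol {k : ℕ} (j : Fin k) : Grp k := Sum.inl j

/-- The group `G_j^q`. -/
def gPair {k : ℕ} (pq : {pq : Fin k × Fin k // pq.1 < pq.2}) : Grp k := Sum.inr (Sum.inl pq)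

/-- The group `G_rest`. -/
def gRest (k : ℕ) : Grp k := Sum.inr (Sum.inr ())

/-- `t = |V(T)|`. -/
noncomputable def tTot (k n : ℕ) (x : Fin n → ℕ) (M : SimpleGraph (Fin k × Fin n)) : ℕ :=
  (Set.univ : Set (VV k n x M)).ncard

/-- `t' = t − Σ_j c_j − Σ_{j<q} c_j^q`, the size of the group `G_rest`. -/
noncomputable def tRest (k n : ℕ) (x : Fin n → ℕ) (M : SimpleGraph (Fin k × Fin n)) : ℕ :=
  tTot k n x M - (∑ j : Fin k, cc k n (j.1 + 1)) -
    ∑ pq : {pq : Fin k × Fin k // pq.1 < pq.2}, cjq k n (pq.1.1.1 + 1) (pq.1.2.1 + 1)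

/-- The prescribed sizes of the groups: `G_j` has size `c_j`, `G_j^q` has size `c_j^q`,
and `G_rest` has size `t'`. -/
noncomputable def sizesMCC (k n : ℕ) (x : Fin n → ℕ) (M : SimpleGraph (Fin k × Fin n)) :
    Grp k → ℕ
  | Sum.inl j => cc k n (j.1 + 1)
  | Sum.inr (Sum.inl pq) => cjq k n (pq.1.1.1 + 1) (pq.1.2.1 + 1)
  | Sum.inr (Sum.inr _) => tRest k n x M

/-- A solution cutting at most `kk` edges: `EP` is a set of at most `kk` edges of `T`, and
`lam` assigns the connected components of `T − EP` to the groups (it is constant on each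
component) so that each group `g` receives exactly `sizes g` vertices. -/
def IsSolutionLe {V G : Type} (T : SimpleGraph V) (EP : Set (Sym2 V)) (kk : ℕ)
    (sizes : G → ℕ) (lam : V → G) : Prop :=
  EP ⊆ T.edgeSet ∧ EP.ncard ≤ kk ∧
    (∀ v w : V, (T.deleteEdges EP).Reachable v w → lam v = lam w) ∧
    ∀ g : G, {v | lam v = g}.ncard = sizes g

/-- `C` is a `P`-component: a connected component of `T − EP`. -/
def IsPComp {V : Type} (T : SimpleGraph V) (EP : Set (Sym2 V)) (C : Set V) : Prop :=
  ∃ v : V, C = {w | (T.deleteEdges EP).Reachable v w}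

/-- `M` contains a multicolored `k`-clique: one vertex of each color class, pairwise adjacent. -/
def HasMCClique (k n : ℕ) (M : SimpleGraph (Fin k × Fin n)) : Prop :=
  ∃ sel : Fin k → Fin n, ∀ j j' : Fin k, j ≠ j' → M.Adj (j, sel j) (j', sel j')

/-- The instance `I'` has a solution. -/
def HasSol (k n : ℕ) (x : Fin n → ℕ) (M : SimpleGraph (Fin k × Fin n)) : Prop :=
  ∃ (EP : Set (Sym2 (VV k n x M))) (lam : VV k n x M → Grp k),
    IsSolutionLe (TG k n x M) EP (KK k) (sizesMCC k n x M) lam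

theorem cardPairs (k : ℕ) : Fintype.card {pq : Fin k × Fin k // pq.1 < pq.2} = Nat.choose k 2 := by
  have h1 : Fintype.card {pq : Fin k × Fin k // pq.1 < pq.2} = (Finset.univ.filter (fun pq : Fin k × Fin k => pq.1 < pq.2)).card := Fintype.card_subtype _
  rw [h1]
  have h2 : (Finset.univ.filter (fun pq : Fin k × Fin k => pq.1 < pq.2)).card = ∑ q : Fin k, q.1 := by
    rw [Finset.card_filter, Fintype.sum_prod_type_right]
    refine Finset.sum_congr rfl fun q _ => ?_
    rw [← Finset.card_filter]
    have : (Finset.univ.filter (fun p : Fin k => p < q)) = Finset.Iio q := by ext; simp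
    rw [this, Fin.card_Iio]
  rw [h2, Fin.sum_univ_eq_sum_range (fun i => i), Finset.sum_range_id, Nat.choose_two_right]

structure Dat (k n : ℕ) (B : Type) [Fintype B] where
  W : ℕ
  K : ℕ
  N : ℕ
  z : ℕ
  bm : ℕ
  L : ℕ
  x : Fin n → ℕ
  b : Fin k → ℕ
  c : Fin k → ℕ
  P : {pq : Fin k × Fin k // pq.1 < pq.2} → ℕ
  vg : Fin k × Fin n → ℕ
  ep : B × Bool → Fin k × Fin n
  tp : B → {pq : Fin k × Fin k // pq.1 < pq.2}
  lA : Fin k × Fin n → Grp k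
  lB : B → Grp k
  lC : B × Bool → Grp k
  hk : 2 ≤ k
  hKW : K + 4 ≤ W
  hkW : 4 * k + 1 ≤ W
  hK : K = k + 3 * Nat.choose k 2
  hx : ∀ i, x i ≤ N
  hN1 : 1 ≤ N
  hNz : W * N ≤ z
  hbz : ∀ j, W * z ≤ b j
  hbb : ∀ i j, i < j → W * b i ≤ b j
  hbm : ∀ j, b j ≤ bm
  hcb : ∀ j, W * bm ≤ c j
  hcc : ∀ i j, i < j → W * c i ≤ c j
  hPc : ∀ j p, W * c j ≤ P p
  hPb : ∀ p, W * W * W * bm ≤ P p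
  hPP : ∀ p q, p ≠ q → W * P p ≤ P q ∨ W * P q ≤ P p
  hvg : ∀ a, vg a + (k - 1) * (b a.1 + x a.2) = c a.1
  hep0 : ∀ e, (ep (e, false)).1 = (tp e).1.1
  hep1 : ∀ e, (ep (e, true)).1 = (tp e).1.2
  hcut : L + (Finset.univ.filter (fun a => lA a ≠ gRest k)).card
    + (Finset.univ.filter (fun a => lB a ≠ gRest k)).card
    + (Finset.univ.filter (fun a => lC a ≠ lB a.1)).card ≤ K
  hcolU : ∀ j, c j ≤ (∑ a with lA a = gCol j, vg a) + (∑ e with lB e = gCol j, P (tp e))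
    + (∑ e with lC e = gCol j, (b (ep e).1 + x (ep e).2)) + L
  hcolL : ∀ j, (∑ a with lA a = gCol j, vg a) + (∑ e with lB e = gCol j, P (tp e))
    + (∑ e with lC e = gCol j, (b (ep e).1 + x (ep e).2)) ≤ c j + L
  hprU : ∀ p, P p ≤ (∑ a with lA a = gPair p, vg a) + (∑ e with lB e = gPair p, P (tp e))
    + (∑ e with lC e = gPair p, (b (ep e).1 + x (ep e).2)) + L
  hprL : ∀ p, (∑ a with lA a = gPair p, vg a) + (∑ e with lB e = gPair p, P (tp e))
    + (∑ e with lC e = gPair p, (b (ep e).1 + x (ep e).2)) ≤ P p + L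

namespace Dat
variable {k n : ℕ} {B : Type} [Fintype B] (d : Dat k n B)

theorem W9 : 9 ≤ d.W := by have := d.hk; have := d.hkW; omega
theorem Wz : d.W ≤ d.z := le_trans (Nat.le_mul_of_pos_right _ d.hN1) d.hNz
theorem zb (j) : d.z ≤ d.b j := le_trans (Nat.le_mul_of_pos_left _ (by have := d.W9; omega)) (d.hbz j)
theorem LK : d.L ≤ d.K := by have := d.hcut; omega
theorem Nz : 9 * d.N ≤ d.z := le_trans (Nat.mul_le_mul_right _ d.W9) d.hNz
theorem bmc (j) : 9 * d.bm ≤ d.c j := le_trans (Nat.mul_le_mul_right _ d.W9) (d.hcb j)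
theorem zbm : d.z ≤ d.bm := by
  have hk := d.hk
  exact le_trans (d.zb ⟨0, by omega⟩) (d.hbm _)

theorem sp_le (a : B × Bool) : d.b (d.ep a).1 + d.x (d.ep a).2 ≤ d.bm + d.N :=
  Nat.add_le_add (d.hbm _) (d.hx _)

theorem cardA (g : Grp k) (hg : g ≠ gRest k) :
    (Finset.univ.filter (fun a => d.lA a = g)).card ≤ (Finset.univ.filter (fun a => d.lA a ≠ gRest k)).card := by
  apply Finset.card_le_card
  intro a; simp; rintro rfl; exact hg
theorem cardB (g : Grp k) (hg : g ≠ gRest k) :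
    (Finset.univ.filter (fun a => d.lB a = g)).card ≤ (Finset.univ.filter (fun a => d.lB a ≠ gRest k)).card := by
  apply Finset.card_le_card
  intro a; simp; rintro rfl; exact hg
theorem cardC (g : Grp k) :
    (Finset.univ.filter (fun a => d.lC a = g)).card ≤
      2 * (Finset.univ.filter (fun a => d.lB a = g)).card
      + (Finset.univ.filter (fun a => d.lC a ≠ d.lB a.1)).card := by
  classical
  have : (Finset.univ.filter (fun a => d.lC a = g)) ⊆
      ((Finset.univ.filter (fun a => d.lB a = g)) ×ˢ (Finset.univ : Finset Bool)) ∪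
       (Finset.univ.filter (fun a => d.lC a ≠ d.lB a.1)) := by
    intro a; simp; rintro rfl
    by_cases h : d.lB a.1 = d.lC a
    · left; exact h
    · right; exact fun h' => h h'.symm
  refine (Finset.card_le_card this).trans ((Finset.card_union_le _ _).trans ?_)
  simp [Finset.card_product]; omega

theorem vg_le (a) : d.vg a ≤ d.c a.1 := by have := d.hvg a; omega

theorem mulk (a : ℕ) : 4 * ((k - 1) * a) + 5 * a ≤ d.W * a := by
  have h1 := d.hkW
  have hk := d.hk
  obtain ⟨m, rfl⟩ : ∃ m, k = m + 1 := ⟨k - 1, by omega⟩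
  have : (4 * (m + 1) + 1) * a ≤ d.W * a := Nat.mul_le_mul_right _ h1
  simp only [Nat.add_sub_cancel]
  nlinarith

/-- edge groups -/
theorem exB (p) : ∃ e, d.lB e = gPair p ∧ d.tp e = p := by
  by_contra hno
  push Not at hno
  have hW := d.W9
  have hWz := d.Wz
  have hzbm := d.zbm
  have hLK := d.LK
  have hKW := d.hKW
  have hPb := d.hPb p
  have hNz := d.Nz
  have hg : (gPair p : Grp k) ≠ gRest k := by simp [gPair, gRest]
  have hA := d.cardA _ hg
  have hB := d.cardB _ hg
  have hC := d.cardC (gPair p)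
  have hcut := d.hcut
  have hWbm : d.bm ≤ d.W * d.bm := Nat.le_mul_of_pos_left _ (by omega)
  have hWbm2 : 9 * (d.W * d.W * d.bm) ≤ d.P p := by nlinarith [Nat.mul_le_mul_right (d.W * d.W * d.bm) hW]
  have hWW : 9 * (d.W * d.bm) ≤ d.W * d.W * d.bm := by nlinarith [Nat.mul_le_mul_right (d.W * d.bm) hW]
  have hWsq : d.W * d.W ≤ d.W * d.bm := Nat.mul_le_mul_left _ (by omega)
  have hU := Nat.mul_le_mul_left d.W (d.hprU p)
  have e1 : d.W * ∑ a with d.lA a = gPair p, d.vg a ≤ (Finset.univ.filter (fun a => d.lA a = gPair p)).card * d.P p := by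
    rw [Finset.mul_sum]
    refine Finset.sum_le_card_nsmul _ _ _ fun a _ => ?_
    exact le_trans (Nat.mul_le_mul_left _ (d.vg_le a)) (d.hPc _ _)
  have e2 : d.W * ∑ e with d.lB e = gPair p, d.P (d.tp e) ≤ (Finset.univ.filter (fun a => d.lB a = gPair p)).card * d.P p := by
    rw [Finset.mul_sum]
    refine Finset.sum_le_card_nsmul _ _ _ fun e he => ?_
    have he' := he
    simp at he'
    rcases d.hPP _ _ (hno e he') with h | h
    · exact h
    · exfalso
      have h1 := d.hprL p
      have h2 := Finset.single_le_sum (f := fun e => d.P (d.tp e)) (fun i _ => Nat.zero_le _) he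
      have := Nat.mul_le_mul_right (d.P p) hW
      omega
  have e3 : ∑ e with d.lC e = gPair p, (d.b (d.ep e).1 + d.x (d.ep e).2) ≤ (Finset.univ.filter (fun a => d.lC a = gPair p)).card * (2 * d.bm) := by
    refine Finset.sum_le_card_nsmul _ _ _ fun a _ => ?_
    have := d.sp_le a
    omega
  have e4 : d.W * ∑ e with d.lC e = gPair p, (d.b (d.ep e).1 + d.x (d.ep e).2) ≤ d.P p := by
    have h1 : (Finset.univ.filter (fun a => d.lC a = gPair p)).card ≤ 2 * d.W := by omega
    calc _ ≤ d.W * (2 * d.W * (2 * d.bm)) := Nat.mul_le_mul_left _ (e3.trans (Nat.mul_le_mul_right _ h1))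
      _ = 4 * (d.W * d.W * d.bm) := by ring
      _ ≤ _ := by omega
  have e5 : d.W * d.L ≤ d.P p := by
    have : d.W * d.L ≤ d.W * d.W := Nat.mul_le_mul_left _ (by omega)
    omega
  have e6 : ((Finset.univ.filter (fun a => d.lA a = gPair p)).card + (Finset.univ.filter (fun a => d.lB a = gPair p)).card) * d.P p ≤ d.K * d.P p :=
    Nat.mul_le_mul_right _ (by omega)
  have e7 : (d.K + 4) * d.P p ≤ d.W * d.P p := Nat.mul_le_mul_right _ hKW
  have : 0 < d.P p := by omega
  simp only [Nat.mul_add, Nat.add_mul] at *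
  omega

theorem colB (j) : (Finset.univ.filter (fun e => d.lB e = gCol j)) = ∅ := by
  rw [Finset.eq_empty_iff_forall_notMem]
  intro e he
  have h1 := d.hcolL j
  have h2 := Finset.single_le_sum (f := fun e => d.P (d.tp e)) (fun i _ => Nat.zero_le _) he
  have h3 := d.hPc j (d.tp e)
  have := Nat.mul_le_mul_right (d.c j) d.W9
  have := d.bmc j
  have hWz := d.Wz
  have hzbm := d.zbm
  have hLK := d.LK
  have hKW := d.hKW
  omega

theorem cardC' (j) :
    (Finset.univ.filter (fun a => d.lC a = gCol j)).card ≤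
      (Finset.univ.filter (fun a => d.lC a ≠ d.lB a.1)).card := by
  have := d.cardC (gCol j)
  rw [d.colB j] at this
  simpa using this

theorem kb_le (a) : 4 * ((k - 1) * (d.b (Prod.fst a) + d.x (Prod.snd a))) ≤ d.W * d.b a.1 + d.z := by
  have h1 := d.mulk (d.b a.1)
  have h2 := d.mulk d.N
  have h3 := d.hNz
  have h4 : (k-1) * d.x a.2 ≤ (k-1) * d.N := Nat.mul_le_mul_left _ (d.hx _)
  rw [Nat.mul_add]
  omega

theorem exA (j) : ∃ i, d.lA (j, i) = gCol j := by
  by_contra hno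
  push Not at hno
  have hW := d.W9
  have hWz := d.Wz
  have hzbm := d.zbm
  have hLK := d.LK
  have hKW := d.hKW
  have hNz := d.Nz
  have hg : (gCol j : Grp k) ≠ gRest k := by simp [gCol, gRest]
  have hA := d.cardA _ hg
  have hC := d.cardC' j
  have hcut := d.hcut
  have hbmc := d.bmc j
  have hU := Nat.mul_le_mul_left d.W (d.hcolU j)
  rw [d.colB j, Finset.sum_empty] at hU
  have e1 : d.W * ∑ a with d.lA a = gCol j, d.vg a ≤ (Finset.univ.filter (fun a => d.lA a = gCol j)).card * d.c j := by
    rw [Finset.mul_sum]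
    refine Finset.sum_le_card_nsmul _ _ _ fun a ha => ?_
    have ha' := ha
    simp at ha'
    refine le_trans (Nat.mul_le_mul_left _ (d.vg_le a)) ?_
    rcases lt_trichotomy a.1 j with h | h | h
    · exact d.hcc _ _ h
    · exact absurd ha' (by rcases a with ⟨a1, a2⟩; simp at h; subst h; exact hno _)
    · exfalso
      have h0 := d.hcc _ _ h
      have h1 := d.hcolL j
      have h2 := Finset.single_le_sum (f := fun e => d.vg e) (fun i _ => Nat.zero_le _) ha
      have h3 := d.hvg a
      have h4 := d.kb_le a
      have h5 : d.W * d.b a.1 ≤ d.W * d.bm := Nat.mul_le_mul_left _ (d.hbm _)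
      have h6 := d.hcb j
      have := Nat.mul_le_mul_right (d.c j) hW
      omega
  have e3 : d.W * ∑ e with d.lC e = gCol j, (d.b (d.ep e).1 + d.x (d.ep e).2) ≤ (Finset.univ.filter (fun a => d.lC a = gCol j)).card * (d.c j + d.bm) := by
    rw [Finset.mul_sum]
    refine Finset.sum_le_card_nsmul _ _ _ fun a _ => ?_
    refine le_trans (Nat.mul_le_mul_left _ (d.sp_le a)) ?_
    have := d.hcb j
    have := d.hNz
    rw [Nat.mul_add]
    omega
  have e5 : d.W * d.L ≤ d.L * d.c j := by
    rw [Nat.mul_comm]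
    exact Nat.mul_le_mul_left _ (by omega)
  have e6 : ((Finset.univ.filter (fun a => d.lA a = gCol j)).card + (Finset.univ.filter (fun a => d.lC a = gCol j)).card + d.L) * d.c j ≤ d.K * d.c j :=
    Nat.mul_le_mul_right _ (by omega)
  have e7 : (d.K + 4) * d.c j ≤ d.W * d.c j := Nat.mul_le_mul_right _ hKW
  have e8 : (Finset.univ.filter (fun a => d.lC a = gCol j)).card * d.bm ≤ d.c j :=
    le_trans (Nat.mul_le_mul_right _ (by omega)) (d.hcb j)
  have : 0 < d.c j := by omega
  simp only [Nat.mul_add, Nat.add_mul] at *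
  omega

theorem colA (j i) (hi : d.lA (j, i) = gCol j) :
    (Finset.univ.filter (fun a => d.lA a = gCol j)) = {(j, i)} := by
  rw [Finset.eq_singleton_iff_unique_mem]
  refine ⟨by simpa using hi, ?_⟩
  intro a ha
  by_contra hne
  have h1 := d.hcolL j
  have h2 := Finset.sum_le_sum_of_subset (f := fun e => d.vg e) (s := {(j, i), a})
    (t := Finset.univ.filter (fun a => d.lA a = gCol j)) (by
      intro y hy; simp at hy; rcases hy with rfl | rfl
      · simpa using hi
      · exact ha)
  rw [Finset.sum_pair (Ne.symm hne)] at h2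
  have h3 := d.hvg a
  have h3' := d.hvg (j, i)
  have h4 := d.kb_le a
  have h4' := d.kb_le (j, i)
  have h5 : d.W * d.b a.1 ≤ d.W * d.bm := Nat.mul_le_mul_left _ (d.hbm _)
  have h5' : d.W * d.b j ≤ d.W * d.bm := Nat.mul_le_mul_left _ (d.hbm _)
  have h6 := d.hcb a.1
  have hWz := d.Wz
  have hzbm := d.zbm
  have hLK := d.LK
  have hKW := d.hKW
  have := Nat.mul_le_mul_right (d.bm) d.W9
  simp only at h3' h4' h2
  omega

theorem colC (j i) (hi : d.lA (j, i) = gCol j) (e) (he : d.lC e = gCol j) : (d.ep e).1 ≤ j := by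
  by_contra h
  push Not at h
  have h1 := d.hcolL j
  rw [d.colA j i hi, Finset.sum_singleton] at h1
  have h2 := Finset.single_le_sum (f := fun e => d.b (d.ep e).1 + d.x (d.ep e).2) (s := (Finset.univ.filter (fun a => d.lC a = gCol j))) (fun i _ => Nat.zero_le _) (by simpa using he)
  have h3 := d.hbb _ _ h
  have h4 := d.hvg (j, i)
  have h5 := d.kb_le (j, i)
  have hWz := d.Wz
  have hzb := d.zb j
  have hLK := d.LK
  have hKW := d.hKW
  have := Nat.mul_le_mul_right (d.b j) d.W9
  simp only at h4 h5
  omega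

def Q (j : Fin k) : Finset (B × Bool) :=
  Finset.univ.filter (fun e => d.lC e = gCol j ∧ (d.ep e).1 = j)

theorem Qcard (j) : k - 1 ≤ (d.Q j).card := by
  classical
  obtain ⟨i, hi⟩ := d.exA j
  by_contra hlt
  push Not at hlt
  have hU := d.hcolU j
  rw [d.colB j, d.colA j i hi, Finset.sum_singleton, Finset.sum_empty] at hU
  have h4 := d.hvg (j, i)
  simp only at h4
  have hC := d.cardC' j
  have hcut := d.hcut
  have hWz := d.Wz
  have hzb := d.zb j
  have hLK := d.LK
  have hKW := d.hKW
  have hbz := d.hbz j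
  have hNz := d.hNz
  have hW := d.W9
  set R := Finset.univ.filter (fun e => d.lC e = gCol j ∧ ¬ (d.ep e).1 = j) with hR
  have hQd : d.Q j = (Finset.univ.filter (fun e => d.lC e = gCol j)).filter (fun e => (d.ep e).1 = j) := by
    rw [Finset.filter_filter]; rfl
  have hRd : R = (Finset.univ.filter (fun e => d.lC e = gCol j)).filter (fun e => ¬ (d.ep e).1 = j) := by
    rw [Finset.filter_filter]
  have hs := Finset.sum_filter_add_sum_filter_not (Finset.univ.filter (fun e => d.lC e = gCol j)) (fun e => (d.ep e).1 = j) (fun e => d.b (d.ep e).1 + d.x (d.ep e).2)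
  have hc := Finset.card_filter_add_card_filter_not (s := Finset.univ.filter (fun e => d.lC e = gCol j)) (fun e => (d.ep e).1 = j)
  rw [← hQd, ← hRd] at hs hc
  have e1 : ∑ e ∈ d.Q j, (d.b (d.ep e).1 + d.x (d.ep e).2) ≤ (d.Q j).card * (d.b j + d.N) := by
    refine Finset.sum_le_card_nsmul _ _ _ fun e he => ?_
    simp [Q] at he
    rw [he.2]
    have := d.hx (d.ep e).2
    omega
  have e2 : d.W * ∑ e ∈ R, (d.b (d.ep e).1 + d.x (d.ep e).2) ≤ R.card * (d.b j + d.W * d.N) := by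
    rw [Finset.mul_sum]
    refine Finset.sum_le_card_nsmul _ _ _ fun e he => ?_
    simp [hR] at he
    have h1 := d.colC j i hi e he.1
    have h2 := d.hbb _ _ (lt_of_le_of_ne h1 he.2)
    have h3 := Nat.mul_le_mul_left d.W (d.hx (d.ep e).2)
    rw [Nat.mul_add]
    omega
  have hW2 : d.W * (d.W * d.N) ≤ d.b j := le_trans (Nat.mul_le_mul_left _ hNz) hbz
  have hWW : d.W * d.W ≤ d.b j := le_trans (Nat.mul_le_mul_left _ hWz) hbz
  have hWL : d.W * d.L ≤ d.b j := le_trans (Nat.mul_le_mul_left _ (by omega)) hWW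
  have hq : ((d.Q j).card + R.card) * (d.W * d.N) ≤ d.b j :=
    le_trans (Nat.mul_le_mul_right _ (by omega)) hW2
  have hr : R.card * d.b j ≤ d.K * d.b j := Nat.mul_le_mul_right _ (by omega)
  have hKb : (d.K + 4) * d.b j ≤ d.W * d.b j := Nat.mul_le_mul_right _ hKW
  have hbpos : 0 < d.b j := by omega
  have hqk : (d.Q j).card * d.b j + d.b j ≤ (k - 1) * d.b j := by
    have := Nat.mul_le_mul_right (d.b j) (show (d.Q j).card + 1 ≤ k - 1 by omega)
    rw [Nat.add_mul, Nat.one_mul] at this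
    exact this
  -- (k-1) b_j ≤ ...
  have m1 : d.b j ≤ (d.Q j).card * d.N + ∑ e ∈ R, (d.b (d.ep e).1 + d.x (d.ep e).2) + d.L := by
    rw [Nat.mul_add] at h4 e1
    omega
  have m2 := Nat.mul_le_mul_left d.W m1
  have m3 : d.W * ((d.Q j).card * d.N) = (d.Q j).card * (d.W * d.N) := by ring
  simp only [Nat.mul_add, Nat.add_mul] at *
  omega

theorem final (hxinj : Function.Injective d.x)
    (hxna : ∀ (g : Fin (k-1) → Fin n) (i : Fin n),
      (∑ j, d.x (g j)) = (k-1) * d.x i → ∀ j, d.x (g j) = d.x i) :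
    ∃ sel : Fin k → Fin n, ∀ p : {pq : Fin k × Fin k // pq.1 < pq.2},
      ∃ e, d.ep (e, false) = (p.1.1, sel p.1.1) ∧ d.ep (e, true) = (p.1.2, sel p.1.2) := by
  classical
  choose sel hsel using d.exA
  choose eb heb htp using d.exB
  have ebinj : Function.Injective eb := fun p q h => by rw [← htp p, ← htp q, h]
  have cP : Fintype.card {pq : Fin k × Fin k // pq.1 < pq.2} = Nat.choose k 2 := cardPairs k
  have h2 : 2 * Nat.choose k 2 = k * (k - 1) := by
    rw [Nat.choose_two_right]; exact Nat.mul_div_cancel' (Nat.even_mul_pred_self k).two_dvd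
  have X1 : Finset.univ.image (fun j => (j, sel j)) ⊆ Finset.univ.filter (fun a => d.lA a ≠ gRest k) := by
    intro a; simp; rintro j rfl; rw [hsel]; simp [gCol, gRest]
  have X2 : (Finset.univ.image (fun j => (j, sel j))).card = k := by
    rw [Finset.card_image_of_injective _ (fun a b h => by simpa using congrArg Prod.fst h)]; simp
  have Y1 : Finset.univ.image eb ⊆ Finset.univ.filter (fun a => d.lB a ≠ gRest k) := by
    intro a; simp only [Finset.mem_image, Finset.mem_univ, true_and, Finset.mem_filter]
    rintro ⟨j, rfl⟩; rw [heb]; simp [gPair, gRest]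
  have Y2 : (Finset.univ.image eb).card = Nat.choose k 2 := by
    rw [Finset.card_image_of_injective _ ebinj, Finset.card_univ, cP]
  have hBne : ∀ e j, d.lB e ≠ gCol j := by
    intro e j he
    have := d.colB j
    rw [Finset.eq_empty_iff_forall_notMem] at this
    exact this e (by simpa using he)
  have Z1 : Finset.univ.biUnion d.Q ⊆ Finset.univ.filter (fun a => d.lC a ≠ d.lB a.1) := by
    intro e; simp only [Finset.mem_biUnion, Finset.mem_univ, true_and, Finset.mem_filter, Q]
    rintro ⟨j, h, _⟩; rw [h]; exact (hBne _ _).symm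
  have Z2 : (Finset.univ.biUnion d.Q).card = ∑ j, (d.Q j).card := by
    apply Finset.card_biUnion
    intro i _ j _ hij
    show Disjoint (d.Q i) (d.Q j)
    rw [Finset.disjoint_left]
    intro e; simp only [Q, Finset.mem_filter, Finset.mem_univ, true_and]
    rintro ⟨_, h⟩ ⟨_, h'⟩; exact hij (h.symm.trans h')
  have Z3 : ∑ j : Fin k, (k - 1) ≤ ∑ j, (d.Q j).card := Finset.sum_le_sum fun j _ => d.Qcard j
  have Z4 : ∑ j : Fin k, (k - 1) = k * (k - 1) := by simp
  have X3 := Finset.card_le_card X1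
  have Y3 := Finset.card_le_card Y1
  have Z5 := Finset.card_le_card Z1
  have hcut := d.hcut
  have hK := d.hK
  have hL : d.L = 0 := by omega
  have X := Finset.eq_of_subset_of_card_le X1 (by omega)
  have Y := Finset.eq_of_subset_of_card_le Y1 (by omega)
  have Z := Finset.eq_of_subset_of_card_le Z1 (by omega)
  have hQ : ∀ j, (d.Q j).card = k - 1 := by
    have := (Finset.sum_eq_sum_iff_of_le (s := Finset.univ) (f := fun _ : Fin k => k - 1) (g := fun j => (d.Q j).card) (fun j _ => d.Qcard j)).1 (by omega)
    intro j; exact (this j (Finset.mem_univ _)).symm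
  have hZ : ∀ e, d.lC e ≠ d.lB e.1 → ∃ j, e ∈ d.Q j := by
    intro e he
    have : e ∈ Finset.univ.biUnion d.Q := by rw [Z]; simpa using he
    simpa using this
  -- color groups
  have hcol : ∀ j e, e ∈ d.Q j → (d.ep e).2 = sel j := by
    intro j e he
    apply hxinj
    have hCQ : Finset.univ.filter (fun e => d.lC e = gCol j) = d.Q j := by
      ext f
      simp only [Finset.mem_filter, Finset.mem_univ, true_and]
      constructor
      · intro hf
        obtain ⟨j', hj'⟩ := hZ f (by rw [hf]; exact (hBne _ _).symm)
        have h1 : d.lC f = gCol j' := by simp [Q] at hj'; exact hj'.1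
        have : j' = j := by rw [hf] at h1; simpa [gCol] using h1.symm
        exact this ▸ hj'
      · intro hf; simp [Q] at hf; exact hf.1
    have hU := d.hcolU j
    have hLo := d.hcolL j
    rw [d.colB j, d.colA j _ (hsel j), Finset.sum_singleton, Finset.sum_empty, hCQ, hL] at hU hLo
    have hv := d.hvg (j, sel j)
    simp only at hv
    have hsum : ∑ e ∈ d.Q j, (d.b (d.ep e).1 + d.x (d.ep e).2) = (k - 1) * d.b j + ∑ e ∈ d.Q j, d.x (d.ep e).2 := by
      rw [Finset.sum_add_distrib]
      congr 1
      rw [← hQ j, ← smul_eq_mul, ← Finset.sum_const]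
      refine Finset.sum_congr rfl fun f hf => ?_
      simp [Q] at hf; rw [hf.2]
    have hx : ∑ e ∈ d.Q j, d.x (d.ep e).2 = (k - 1) * d.x (sel j) := by
      rw [Nat.mul_add] at hv; omega
    let φ := ((d.Q j).equivFinOfCardEq (hQ j))
    have := hxna (fun t => (d.ep (φ.symm t).1).2) (sel j) (by
      rw [← hx, ← Finset.sum_coe_sort (d.Q j)]
      exact Equiv.sum_comp φ.symm (fun e => d.x (d.ep e.1).2)) (φ ⟨e, he⟩)
    simpa using this
  have hpr : ∀ p s, ∃ j, (eb p, s) ∈ d.Q j := by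
    intro p s
    apply hZ
    simp only
    rw [heb]
    intro hs
    have hLo := d.hprL p
    have h1 := Finset.single_le_sum (f := fun e => d.b (d.ep e).1 + d.x (d.ep e).2) (s := (Finset.univ.filter (fun a => d.lC a = gPair p))) (fun i _ => Nat.zero_le _) (a := (eb p, s)) (by simpa using hs)
    have h2 := Finset.single_le_sum (f := fun e => d.P (d.tp e)) (s := (Finset.univ.filter (fun a => d.lB a = gPair p))) (fun i _ => Nat.zero_le _) (a := eb p) (by simpa using heb p)
    simp only [htp] at h1 h2
    have h3 := d.zb (d.ep (eb p, s)).1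
    have := d.Wz
    have := d.W9
    omega
  refine ⟨sel, fun p => ⟨eb p, ?_, ?_⟩⟩
  · obtain ⟨j, hj⟩ := hpr p false
    have h1 := hcol j _ hj
    simp only [Q, Finset.mem_filter] at hj
    have h2 := d.hep0 (eb p)
    rw [htp] at h2
    have : j = p.1.1 := by rw [← h2, hj.2.2]
    ext1
    · exact h2
    · rw [h1, this]
  · obtain ⟨j, hj⟩ := hpr p true
    have h1 := hcol j _ hj
    simp only [Q, Finset.mem_filter] at hj
    have h2 := d.hep1 (eb p)
    rw [htp] at h2
    have : j = p.1.2 := by rw [← h2, hj.2.2]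
    ext1
    · exact h2
    · rw [h1, this]

end Dat

noncomputable instance instFE (k n : ℕ) (M : SimpleGraph (Fin k × Fin n)) : Fintype (EIdx k n M) := by
  classical
  unfold EIdx
  infer_instance

def par (k n : ℕ) (x : Fin n → ℕ) (M : SimpleGraph (Fin k × Fin n)) : VV k n x M → VV k n x M
  | Sum.inl _ => Sum.inl ()
  | Sum.inr (Sum.inl ⟨_, none⟩) => Sum.inl ()
  | Sum.inr (Sum.inl ⟨v, some _⟩) => vgRoot k n x M v
  | Sum.inr (Sum.inr (Sum.inl ⟨_, Sum.inl none⟩)) => Sum.inl ()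
  | Sum.inr (Sum.inr (Sum.inl ⟨e, Sum.inl (some _)⟩)) => seRoot k n x e
  | Sum.inr (Sum.inr (Sum.inl ⟨e, Sum.inr (Sum.inl none)⟩)) => seRoot k n x e
  | Sum.inr (Sum.inr (Sum.inl ⟨e, Sum.inr (Sum.inl (some _))⟩)) => sp1Root k n x e
  | Sum.inr (Sum.inr (Sum.inl ⟨e, Sum.inr (Sum.inr none)⟩)) => seRoot k n x e
  | Sum.inr (Sum.inr (Sum.inl ⟨e, Sum.inr (Sum.inr (some _))⟩)) => sp2Root k n x e
  | Sum.inr (Sum.inr (Sum.inr (_, none))) => Sum.inl ()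
  | Sum.inr (Sum.inr (Sum.inr (c, some _))) => Sum.inr (Sum.inr (Sum.inr (c, none)))

theorem par_spec (k n : ℕ) (x : Fin n → ℕ) (M : SimpleGraph (Fin k × Fin n)) (w : VV k n x M) :
    w = Sum.inl () ∨ (relMCC k n x M (par k n x M w) w ∧ par k n x M w ≠ w ∧
      par k n x M (par k n x M w) ≠ w) := by
  rcases w with w | ⟨v, _ | i⟩ | ⟨e, (_ | i) | (_ | i) | (_ | i)⟩ | ⟨c, _ | i⟩ <;>
    simp [par, relMCC, vgRoot, seRoot, sp1Root, sp2Root, code, codeRel]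

theorem dev_card (k n : ℕ) (x : Fin n → ℕ) (M : SimpleGraph (Fin k × Fin n))
    (EP : Set (Sym2 (VV k n x M))) (lam : VV k n x M → Grp k)
    (h : IsSolutionLe (TG k n x M) EP (KK k) (sizesMCC k n x M) lam) :
    {w | lam w ≠ lam (par k n x M w)}.ncard ≤ KK k := by
  obtain ⟨-, hc, hl, -⟩ := h
  have key : ∀ w, lam w ≠ lam (par k n x M w) → w ≠ Sum.inl () := by
    rintro w hw rfl; exact hw rfl
  refine le_trans (Set.ncard_le_ncard_of_injOn (t := EP) (fun w => s(par k n x M w, w)) ?_ ?_ (Set.toFinite _)) hc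
  · intro w hw
    by_contra hn
    have hw' : lam w ≠ lam (par k n x M w) := hw
    rcases par_spec k n x M w with h0 | ⟨h1, h2, -⟩
    · exact key w hw' h0
    · apply hw'
      symm
      apply hl
      apply SimpleGraph.Adj.reachable
      rw [SimpleGraph.deleteEdges_adj]
      refine ⟨?_, hn⟩
      rw [TG, SimpleGraph.fromRel_adj]
      exact ⟨h2, Or.inl h1⟩
  · intro w hw w' hw' he
    have hw1 : lam w ≠ lam (par k n x M w) := hw
    simp only [Sym2.eq_iff] at he
    rcases he with h | ⟨h, h'⟩
    · exact h.2
    · exfalso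
      rcases par_spec k n x M w with h0 | ⟨-, -, h3⟩
      · exact key w hw1 h0
      · rw [h] at h3; exact h3 h'.symm

theorem starU {G : Type} [DecidableEq G] (m : ℕ) (hm : 1 ≤ m) (a : G) (f : Fin (m - 1) → G) (g : G) :
    (if a = g then 1 else 0) + (∑ i, if f i = g then 1 else 0) ≤
      (if a = g then m else 0) + (∑ i, if f i ≠ a then 1 else 0) := by
  by_cases h : a = g
  · have : (∑ i, if f i = g then 1 else 0) ≤ ∑ i : Fin (m-1), 1 :=
      Finset.sum_le_sum fun i _ => by split_ifs <;> simp
    simp only [Finset.sum_const, Finset.card_univ, Fintype.card_fin, smul_eq_mul, mul_one] at this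
    simp only [h, if_true]
    omega
  · have : (∑ i, if f i = g then 1 else 0) ≤ (∑ i, if f i ≠ a then 1 else 0) :=
      Finset.sum_le_sum fun i _ => by
        by_cases h' : f i = g
        · rw [if_pos h', if_pos]; rw [h']; exact fun h'' => h h''.symm
        · simp [h']
    simpa [h] using this

theorem starL {G : Type} [DecidableEq G] (m : ℕ) (hm : 1 ≤ m) (a : G) (f : Fin (m - 1) → G) (g : G) :
    (if a = g then m else 0) ≤
    (if a = g then 1 else 0) + (∑ i, if f i = g then 1 else 0) +
       (∑ i, if f i ≠ a then 1 else 0) := by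
  by_cases h : a = g
  · subst h
    rw [add_assoc, ← Finset.sum_add_distrib]
    have : ∑ i : Fin (m-1), 1 ≤ (∑ i, ((if f i = a then 1 else 0) + if f i ≠ a then 1 else 0)) :=
      Finset.sum_le_sum fun i _ => by by_cases h' : f i = a <;> simp [h']
    simp only [Finset.sum_const, Finset.card_univ, Fintype.card_fin, smul_eq_mul, mul_one] at this
    simp only [if_true]
    omega
  · simp [h]

/-! numbers -/

def rk (k j q : ℕ) : ℕ := (j-1)*k - j*(j-1)/2 + q - j

theorem rk_lt {k j q j' q' : ℕ} (h1 : j < q) (h2 : q < k) (h3 : j' < q') (h4 : q' < k)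
    (h : j < j' ∨ (j = j' ∧ q < q')) : rk k (j+1) (q+1) < rk k (j'+1) (q'+1) := by
  unfold rk
  simp only [Nat.add_sub_cancel]
  have e1 : 2 * ((j+1)*j/2) = (j+1)*j := Nat.mul_div_cancel' (by rw [mul_comm]; exact (Nat.even_mul_succ_self j).two_dvd)
  have e2 : 2 * ((j'+1)*j'/2) = (j'+1)*j' := Nat.mul_div_cancel' (by rw [mul_comm]; exact (Nat.even_mul_succ_self j').two_dvd)
  have f1 : (j+1)*j ≤ j * k := by rw [mul_comm]; exact Nat.mul_le_mul_left _ (by omega)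
  have f2 : (j'+1)*j' ≤ j' * k := by rw [mul_comm]; exact Nat.mul_le_mul_left _ (by omega)
  rcases h with h | ⟨rfl, h⟩
  · obtain ⟨t, rfl⟩ : ∃ t, j' = j + 1 + t := ⟨j' - j - 1, by omega⟩
    obtain ⟨u, rfl⟩ : ∃ u, k = j + 1 + t + 1 + u := ⟨k - (j + 1 + t + 1), by omega⟩
    generalize (j+1)*j/2 = A at *
    generalize (j+1+t+1)*(j+1+t)/2 = A' at *
    have key : 2 * (j * (j + 1 + t + 1 + u)) + 2 * (t + 1 + u) + 2 * A' ≤ 2 * ((j + 1 + t) * (j + 1 + t + 1 + u)) + 2 * A := by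
      rw [e1, e2]; nlinarith [Nat.zero_le (t*u), Nat.zero_le (t*t), Nat.zero_le t]
    omega
  · omega

theorem rk_pos {k j q : ℕ} (h1 : j < q) : 1 ≤ rk k (j+1) (q+1) := by
  unfold rk; omega

theorem k0_three {k : ℕ} (hk : 2 ≤ k) : 1 ≤ Nat.choose k 2 := Nat.choose_pos hk

theorem hKW' {k : ℕ} (hk : 2 ≤ k) : KK k + 4 ≤ k0 k ^ 2 := by
  have := k0_three hk
  unfold KK k0
  generalize Nat.choose k 2 = C at *
  obtain ⟨a, rfl⟩ : ∃ a, k = 2 + a := ⟨k - 2, by omega⟩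
  obtain ⟨b, rfl⟩ : ∃ b, C = 1 + b := ⟨C - 1, by omega⟩
  nlinarith [Nat.zero_le (a*b), Nat.zero_le (a*a), Nat.zero_le (b*b)]

theorem hkW' {k : ℕ} (hk : 2 ≤ k) : 4 * k + 1 ≤ k0 k ^ 2 := by
  have := k0_three hk
  unfold k0
  generalize Nat.choose k 2 = C at *
  obtain ⟨a, rfl⟩ : ∃ a, k = 2 + a := ⟨k - 2, by omega⟩
  obtain ⟨b, rfl⟩ : ∃ b, C = 1 + b := ⟨C - 1, by omega⟩
  nlinarith [Nat.zero_le (a*b), Nat.zero_le (a*a), Nat.zero_le (b*b)]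

theorem pw {k a b : ℕ} (hk : 2 ≤ k) (h : a < b) : k0 k ^ 2 * k0 k ^ (2 * a) ≤ k0 k ^ (2 * b) := by
  rw [← pow_add]; exact Nat.pow_le_pow_right (by unfold k0; omega) (by omega)
theorem pw0 {k a b : ℕ} (hk : 2 ≤ k) (h : a ≤ b) : k0 k ^ (2 * a) ≤ k0 k ^ (2 * b) := by
  exact Nat.pow_le_pow_right (by unfold k0; omega) (by omega)

theorem cjq_eq (k n j q : ℕ) : cjq k n j q = k0 k ^ (2 * (2 * k + rk k j q)) * z k n := by
  unfold cjq cc rk; rw [mul_right_comm, ← pow_add]; congr 2; ring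

theorem z_pos {k n : ℕ} (hk : 2 ≤ k) (hn : 1 ≤ n) : 1 ≤ z k n := by
  unfold z
  have h1 : 0 < k0 k := by unfold k0; omega
  have h2 : 0 < n := hn
  show 0 < k0 k ^ 2 * n ^ 5
  positivity

theorem mz {W a b zz : ℕ} (h : W * a ≤ b) : W * (a * zz) ≤ b * zz := by
  rw [← mul_assoc]; exact Nat.mul_le_mul_right _ h

theorem vg_eq {k n : ℕ} (hk : 2 ≤ k) (hn : 1 ≤ n) (x : Fin n → ℕ) (hxbd : ∀ i, x i ≤ n^4)
    (a : Fin k × Fin n) :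
    vgSize k n x a + (k - 1) * (bb k n (a.1.1 + 1) + x a.2) = cc k n (a.1.1 + 1) ∧ 1 ≤ vgSize k n x a := by
  have h1 : k0 k ^ 2 * bb k n (a.1.1 + 1) ≤ cc k n (a.1.1 + 1) := mz (pw hk (by omega))
  have hz := z_pos hk hn
  have h2 : z k n ≤ bb k n (a.1.1 + 1) := Nat.le_mul_of_pos_left _ (Nat.pow_pos (by unfold k0; omega))
  have h3 : x a.2 ≤ z k n := by
    refine (hxbd a.2).trans ?_
    unfold z
    calc n^4 ≤ n^5 := Nat.pow_le_pow_right hn (by omega)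
      _ ≤ _ := Nat.le_mul_of_pos_left _ (Nat.pow_pos (by unfold k0; omega))
  have h4 : (4 * k + 1) * bb k n (a.1.1 + 1) ≤ _ := Nat.mul_le_mul_right _ (hkW' hk)
  have h5 : (k - 1) * x a.2 ≤ (k - 1) * bb k n (a.1.1 + 1) := Nat.mul_le_mul_left _ (by omega)
  have h6 : (k - 1) * bb k n (a.1.1 + 1) ≤ k * bb k n (a.1.1 + 1) := Nat.mul_le_mul_right _ (by omega)
  unfold vgSize
  rw [Nat.add_mul, mul_assoc] at h4
  rw [Nat.mul_add]
  omega

theorem fix_big {k n : ℕ} (hk : 2 ≤ k) (hn : 1 ≤ n) (x : Fin n → ℕ) (M : SimpleGraph (Fin k × Fin n))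
    (g : Grp k) (hg : g ≠ gRest k) : sizesMCC k n x M g + KK k < fixSize k n := by
  have : sizesMCC k n x M g ≤ cjq k n (k-1) k := by
    rw [cjq_eq]
    rcases g with j | p | u
    · exact Nat.mul_le_mul_right _ (pw0 hk (by omega))
    · show cjq k n (p.1.1.1 + 1) (p.1.2.1 + 1) ≤ _
      rw [cjq_eq]
      refine Nat.mul_le_mul_right _ (pw0 hk ?_)
      have hp : p.1.1.1 < p.1.2.1 := p.2
      have hq := p.1.2.2
      by_cases h : p.1.1.1 = k - 2 ∧ p.1.2.1 = k - 1
      · rw [h.1, h.2, show k - 2 + 1 = k - 1 by omega, show k - 1 + 1 = k by omega]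
      · have := rk_lt (k := k) hp hq (j' := k - 2) (q' := k - 1) (by omega) (by omega) (by omega)
        rw [show k - 2 + 1 = k - 1 by omega, show k - 1 + 1 = k by omega] at this
        omega
    · exact absurd rfl hg
  unfold fixSize
  omega


def tpE {k n : ℕ} {M : SimpleGraph (Fin k × Fin n)} (e : EIdx k n M) :
    {pq : Fin k × Fin k // pq.1 < pq.2} := ⟨(e.1.1.1, e.1.2.1), e.2.2⟩

def epE {k n : ℕ} {M : SimpleGraph (Fin k × Fin n)} (e : EIdx k n M × Bool) : Fin k × Fin n :=
  if e.2 then e.1.1.2 else e.1.1.1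

theorem sum_split (k n : ℕ) (x : Fin n → ℕ) (M : SimpleGraph (Fin k × Fin n)) (f : VV k n x M → ℕ) :
    ∑ w, f w = f (Sum.inl ())
    + (∑ v, (f (Sum.inr (Sum.inl ⟨v, none⟩)) + ∑ i, f (Sum.inr (Sum.inl ⟨v, some i⟩))))
    + (∑ e, (f (Sum.inr (Sum.inr (Sum.inl ⟨e, Sum.inl none⟩))) + ∑ i, f (Sum.inr (Sum.inr (Sum.inl ⟨e, Sum.inl (some i)⟩)))))
    + (∑ e, (f (Sum.inr (Sum.inr (Sum.inl ⟨e, Sum.inr (Sum.inl none)⟩))) + ∑ i, f (Sum.inr (Sum.inr (Sum.inl ⟨e, Sum.inr (Sum.inl (some i))⟩)))))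
    + (∑ e, (f (Sum.inr (Sum.inr (Sum.inl ⟨e, Sum.inr (Sum.inr none)⟩))) + ∑ i, f (Sum.inr (Sum.inr (Sum.inl ⟨e, Sum.inr (Sum.inr (some i))⟩)))))
    + (∑ c, (f (Sum.inr (Sum.inr (Sum.inr (c, none)))) + ∑ i, f (Sum.inr (Sum.inr (Sum.inr (c, some i)))))) := by
  rw [Fintype.sum_sum_type, Fintype.sum_sum_type, Fintype.sum_sum_type, Fintype.sum_sigma, Fintype.sum_sigma]
  have h : ∑ p : Fin (KK k + 1) × Option (Fin (fixSize k n - 1)), f (Sum.inr (Sum.inr (Sum.inr p)))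
      = ∑ c, ∑ o, f (Sum.inr (Sum.inr (Sum.inr (c, o)))) := Fintype.sum_prod_type _
  have h0 : ∑ u : Unit, f (Sum.inl u) = f (Sum.inl ()) := Fintype.sum_unique _
  rw [h, h0]
  simp only [Fintype.sum_sum_type, Fintype.sum_option, Finset.sum_add_distrib]
  ring

theorem sumBB {B : Type} [Fintype B] (f : B × Bool → ℕ) :
    ∑ p, f p = (∑ e, f (e, false)) + ∑ e, f (e, true) := by
  rw [Fintype.sum_prod_type, ← Finset.sum_add_distrib]
  refine Finset.sum_congr rfl fun e _ => ?_
  rw [Fintype.sum_bool, add_comm]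

section
variable {k n : ℕ} {x : Fin n → ℕ} {M : SimpleGraph (Fin k × Fin n)} (lam : VV k n x M → Grp k)

def lAf (v : Fin k × Fin n) : Grp k := lam (Sum.inr (Sum.inl ⟨v, none⟩))
def lBf (e : EIdx k n M) : Grp k := lam (Sum.inr (Sum.inr (Sum.inl ⟨e, Sum.inl none⟩)))
def l1f (e : EIdx k n M) : Grp k := lam (Sum.inr (Sum.inr (Sum.inl ⟨e, Sum.inr (Sum.inl none)⟩)))
def l2f (e : EIdx k n M) : Grp k := lam (Sum.inr (Sum.inr (Sum.inl ⟨e, Sum.inr (Sum.inr none)⟩)))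
def lCf (e : EIdx k n M × Bool) : Grp k := if e.2 then l2f lam e.1 else l1f lam e.1
def lFf (c : Fin (KK k + 1)) : Grp k := lam (Sum.inr (Sum.inr (Sum.inr (c, none))))

def dA (v : Fin k × Fin n) : ℕ :=
  ∑ i, if lam (Sum.inr (Sum.inl ⟨v, some i⟩)) ≠ lAf lam v then 1 else 0
def dB (e : EIdx k n M) : ℕ :=
  ∑ i, if lam (Sum.inr (Sum.inr (Sum.inl ⟨e, Sum.inl (some i)⟩))) ≠ lBf lam e then 1 else 0
def d1 (e : EIdx k n M) : ℕ :=
  ∑ i, if lam (Sum.inr (Sum.inr (Sum.inl ⟨e, Sum.inr (Sum.inl (some i))⟩))) ≠ l1f lam e then 1 else 0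
def d2 (e : EIdx k n M) : ℕ :=
  ∑ i, if lam (Sum.inr (Sum.inr (Sum.inl ⟨e, Sum.inr (Sum.inr (some i))⟩))) ≠ l2f lam e then 1 else 0
def dF (c : Fin (KK k + 1)) : ℕ :=
  ∑ i, if lam (Sum.inr (Sum.inr (Sum.inr (c, some i)))) ≠ lFf lam c then 1 else 0

noncomputable def Lf : ℕ := (∑ v, dA lam v) + (∑ e, dB lam e) + (∑ e, d1 lam e) + (∑ e, d2 lam e) + ∑ c, dF lam c

theorem dev_eq : {w | lam w ≠ lam (par k n x M w)}.ncard =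
    Lf lam + (∑ v, if lAf lam v ≠ lam (Sum.inl ()) then 1 else 0)
     + (∑ e, if lBf lam e ≠ lam (Sum.inl ()) then 1 else 0)
     + (∑ e, if l1f lam e ≠ lBf lam e then 1 else 0)
     + (∑ e, if l2f lam e ≠ lBf lam e then 1 else 0)
     + (∑ c, if lFf lam c ≠ lam (Sum.inl ()) then 1 else 0) := by
  rw [Set.ncard_eq_toFinset_card', Set.toFinset_ofPred, Finset.card_filter]
  rw [sum_split]
  have e : 0 + (∑ v, ((if lAf lam v ≠ lam (Sum.inl ()) then 1 else 0) + dA lam v))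
      + (∑ e, ((if lBf lam e ≠ lam (Sum.inl ()) then 1 else 0) + dB lam e))
      + (∑ e, ((if l1f lam e ≠ lBf lam e then 1 else 0) + d1 lam e))
      + (∑ e, ((if l2f lam e ≠ lBf lam e then 1 else 0) + d2 lam e))
      + (∑ c, ((if lFf lam c ≠ lam (Sum.inl ()) then 1 else 0) + dF lam c)) =
      Lf lam + (∑ v, if lAf lam v ≠ lam (Sum.inl ()) then 1 else 0)
     + (∑ e, if lBf lam e ≠ lam (Sum.inl ()) then 1 else 0)
     + (∑ e, if l1f lam e ≠ lBf lam e then 1 else 0)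
     + (∑ e, if l2f lam e ≠ lBf lam e then 1 else 0)
     + (∑ c, if lFf lam c ≠ lam (Sum.inl ()) then 1 else 0) := by
    simp only [Finset.sum_add_distrib, Lf]
    ring
  rw [← e, if_neg (fun h => h rfl)]
  rfl

theorem class_eq (g : Grp k) : {w | lam w = g}.ncard =
    (if lam (Sum.inl ()) = g then 1 else 0) +
    (∑ v, ((if lAf lam v = g then 1 else 0) + ∑ i, if lam (Sum.inr (Sum.inl ⟨v, some i⟩)) = g then 1 else 0))
    + (∑ e, ((if lBf lam e = g then 1 else 0) + ∑ i, if lam (Sum.inr (Sum.inr (Sum.inl ⟨e, Sum.inl (some i)⟩))) = g then 1 else 0))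
    + (∑ e, ((if l1f lam e = g then 1 else 0) + ∑ i, if lam (Sum.inr (Sum.inr (Sum.inl ⟨e, Sum.inr (Sum.inl (some i))⟩))) = g then 1 else 0))
    + (∑ e, ((if l2f lam e = g then 1 else 0) + ∑ i, if lam (Sum.inr (Sum.inr (Sum.inl ⟨e, Sum.inr (Sum.inr (some i))⟩))) = g then 1 else 0))
    + (∑ c, ((if lFf lam c = g then 1 else 0) + ∑ i, if lam (Sum.inr (Sum.inr (Sum.inr (c, some i)))) = g then 1 else 0)) := by
  rw [Set.ncard_eq_toFinset_card', Set.toFinset_ofPred, Finset.card_filter]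
  rw [sum_split]
  rfl

theorem sp_pos (hk : 2 ≤ k) (hn : 1 ≤ n) (v : Fin k × Fin n) : 1 ≤ spSize k n x v := by
  have hz := z_pos hk hn
  have h2 : z k n ≤ bb k n (v.1.1 + 1) := Nat.le_mul_of_pos_left _ (Nat.pow_pos (by unfold k0; omega))
  unfold spSize; omega

theorem se_pos (hk : 2 ≤ k) (hn : 1 ≤ n) (e : EIdx k n M) : 1 ≤ seSize k n e := by
  unfold seSize
  rw [cjq_eq]
  exact (z_pos hk hn).trans (Nat.le_mul_of_pos_left _ (Nat.pow_pos (by unfold k0; omega)))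

theorem class_le (hk : 2 ≤ k) (hn : 1 ≤ n) (hxbd : ∀ i, x i ≤ n^4) (g : Grp k) :
    {w | lam w = g}.ncard ≤ (if lam (Sum.inl ()) = g then 1 else 0) +
    (∑ v, if lAf lam v = g then vgSize k n x v else 0)
    + (∑ e, if lBf lam e = g then seSize k n e else 0)
    + (∑ e, if l1f lam e = g then spSize k n x e.1.1 else 0)
    + (∑ e, if l2f lam e = g then spSize k n x e.1.2 else 0)
    + (∑ c, if lFf lam c = g then fixSize k n else 0) + Lf lam := by
  have hA := Finset.sum_le_sum (s := Finset.univ) fun v _ =>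
    starU (vgSize k n x v) (vg_eq hk hn x hxbd v).2 (lAf lam v) (fun i => lam (Sum.inr (Sum.inl ⟨v, some i⟩))) g
  have hB := Finset.sum_le_sum (s := Finset.univ) fun e _ =>
    starU (seSize k n e) (se_pos hk hn e) (lBf lam e) (fun i => lam (Sum.inr (Sum.inr (Sum.inl ⟨e, Sum.inl (some i)⟩)))) g
  have h1 := Finset.sum_le_sum (s := Finset.univ) fun e _ =>
    starU (spSize k n x (Subtype.val e).1) (sp_pos hk hn _) (l1f lam e) (fun i => lam (Sum.inr (Sum.inr (Sum.inl ⟨e, Sum.inr (Sum.inl (some i))⟩)))) g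
  have h2 := Finset.sum_le_sum (s := Finset.univ) fun e _ =>
    starU (spSize k n x (Subtype.val e).2) (sp_pos hk hn _) (l2f lam e) (fun i => lam (Sum.inr (Sum.inr (Sum.inl ⟨e, Sum.inr (Sum.inr (some i))⟩)))) g
  have hF := Finset.sum_le_sum (s := Finset.univ) fun c _ =>
    starU (fixSize k n) (by unfold fixSize; omega) (lFf lam c) (fun i => lam (Sum.inr (Sum.inr (Sum.inr (c, some i))))) g
  rw [class_eq]
  simp only [Finset.sum_add_distrib] at *
  unfold Lf dA dB d1 d2 dF
  convert Nat.add_le_add (Nat.add_le_add (Nat.add_le_add (Nat.add_le_add (Nat.add_le_add_left hA (if lam (Sum.inl ()) = g then 1 else 0)) hB) h1) h2) hF using 1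
  · ring

theorem class_ge (hk : 2 ≤ k) (hn : 1 ≤ n) (hxbd : ∀ i, x i ≤ n^4) (g : Grp k) :
    (∑ v, if lAf lam v = g then vgSize k n x v else 0)
    + (∑ e, if lBf lam e = g then seSize k n e else 0)
    + (∑ e, if l1f lam e = g then spSize k n x e.1.1 else 0)
    + (∑ e, if l2f lam e = g then spSize k n x e.1.2 else 0)
    + (∑ c, if lFf lam c = g then fixSize k n else 0) ≤ {w | lam w = g}.ncard + Lf lam := by
  have hA := Finset.sum_le_sum (s := Finset.univ) fun v _ =>
    starL (vgSize k n x v) (vg_eq hk hn x hxbd v).2 (lAf lam v) (fun i => lam (Sum.inr (Sum.inl ⟨v, some i⟩))) g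
  have hB := Finset.sum_le_sum (s := Finset.univ) fun e _ =>
    starL (seSize k n e) (se_pos hk hn e) (lBf lam e) (fun i => lam (Sum.inr (Sum.inr (Sum.inl ⟨e, Sum.inl (some i)⟩)))) g
  have h1 := Finset.sum_le_sum (s := Finset.univ) fun e _ =>
    starL (spSize k n x (Subtype.val e).1) (sp_pos hk hn _) (l1f lam e) (fun i => lam (Sum.inr (Sum.inr (Sum.inl ⟨e, Sum.inr (Sum.inl (some i))⟩)))) g
  have h2 := Finset.sum_le_sum (s := Finset.univ) fun e _ =>
    starL (spSize k n x (Subtype.val e).2) (sp_pos hk hn _) (l2f lam e) (fun i => lam (Sum.inr (Sum.inr (Sum.inl ⟨e, Sum.inr (Sum.inr (some i))⟩)))) g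
  have hF := Finset.sum_le_sum (s := Finset.univ) fun c _ =>
    starL (fixSize k n) (by unfold fixSize; omega) (lFf lam c) (fun i => lam (Sum.inr (Sum.inr (Sum.inr (c, some i))))) g
  rw [class_eq]
  have key := Nat.add_le_add (Nat.add_le_add (Nat.add_le_add (Nat.add_le_add hA hB) h1) h2) hF
  simp only [Finset.sum_add_distrib] at *
  unfold Lf dA dB d1 d2 dF
  refine le_trans (le_of_eq ?_) (key.trans (le_trans (Nat.le_add_left _ (if lam (Sum.inl ()) = g then 1 else 0)) (le_of_eq ?_)))
  · rfl
  · ring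
end

theorem mainThm
    (k n : ℕ) (hk : 2 ≤ k) (hn : 1 ≤ n)
    (x : Fin n → ℕ) (hxinj : Function.Injective x) (hxbd : ∀ i, x i ≤ n^4)
    (hxna : ∀ (g : Fin (k-1) → Fin n) (i : Fin n),
      (∑ j, x (g j)) = (k-1) * x i → ∀ j, x (g j) = x i)
    (M : SimpleGraph (Fin k × Fin n))
    (hsol : HasSol k n x M) : HasMCClique k n M := by
  obtain ⟨EP, lam, h⟩ := hsol
  have hdev := dev_card k n x M EP lam h
  rw [dev_eq] at hdev
  have hsz := h.2.2.2
  have hLK : Lf lam ≤ KK k := by omega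
  have hF : ∀ c, lFf lam c = gRest k := by
    intro c
    by_contra hc
    have h1 := class_ge lam hk hn hxbd (lFf lam c)
    rw [hsz] at h1
    have h2 := fix_big hk hn x M _ hc
    have h3 := Finset.single_le_sum (f := fun c' => if lFf lam c' = lFf lam c then fixSize k n else 0) (s := Finset.univ) (fun i _ => Nat.zero_le _) (Finset.mem_univ c)
    simp only [if_true] at h3
    omega
  have hr : lam (Sum.inl ()) = gRest k := by
    by_contra hr
    have : ∀ c, lFf lam c ≠ lam (Sum.inl ()) := fun c hc => hr (hc ▸ hF c)
    simp [this] at hdev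
    omega
  rw [hr] at hdev
  have hU : ∀ g, g ≠ gRest k → sizesMCC k n x M g ≤ (∑ a with lAf lam a = g, vgSize k n x a)
      + (∑ e with lBf lam e = g, cjq k n ((tpE e).1.1.1 + 1) ((tpE e).1.2.1 + 1))
      + (∑ e with lCf lam e = g, (bb k n ((epE e).1.1 + 1) + x (epE e).2)) + Lf lam := by
    intro g hg
    have h1 := class_le lam hk hn hxbd g
    rw [hsz, hr] at h1
    simp only [hF, hg.symm, if_false, Finset.sum_const_zero, Nat.zero_add, Nat.add_zero] at h1
    rw [Finset.sum_filter, Finset.sum_filter, Finset.sum_filter, sumBB]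
    simp only [lCf, epE]
    simp only [spSize, seSize] at h1
    simp only [tpE, if_true, Bool.false_eq_true, if_false]
    omega
  have hLo : ∀ g, g ≠ gRest k → (∑ a with lAf lam a = g, vgSize k n x a)
      + (∑ e with lBf lam e = g, cjq k n ((tpE e).1.1.1 + 1) ((tpE e).1.2.1 + 1))
      + (∑ e with lCf lam e = g, (bb k n ((epE e).1.1 + 1) + x (epE e).2)) ≤ sizesMCC k n x M g + Lf lam := by
    intro g hg
    have h1 := class_ge lam hk hn hxbd g
    rw [hsz] at h1
    simp only [hF, hg.symm, if_false, Finset.sum_const_zero, Nat.add_zero] at h1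
    rw [Finset.sum_filter, Finset.sum_filter, Finset.sum_filter, sumBB]
    simp only [lCf, epE]
    simp only [spSize, seSize] at h1
    simp only [tpE, if_true, Bool.false_eq_true, if_false]
    omega
  have hcol : ∀ j : Fin k, gCol j ≠ gRest k := by intro j; simp [gCol, gRest]
  have hpair : ∀ p, gPair p ≠ gRest k := by intro j; simp [gPair, gRest]
  let D : Dat k n (EIdx k n M) :=
    { W := k0 k ^ 2, K := KK k, N := n ^ 4, z := z k n, bm := bb k n k, L := Lf lam, x := x
      b := fun j => bb k n (j.1 + 1)
      c := fun j => cc k n (j.1 + 1)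
      P := fun p => cjq k n (p.1.1.1 + 1) (p.1.2.1 + 1)
      vg := vgSize k n x
      ep := epE, tp := tpE, lA := lAf lam, lB := lBf lam, lC := lCf lam
      hk := hk, hKW := hKW' hk, hkW := hkW' hk, hK := rfl, hx := hxbd
      hN1 := Nat.pow_pos hn
      hNz := Nat.mul_le_mul_left _ (Nat.pow_le_pow_right hn (by omega))
      hbz := fun j => by
        have := mz (zz := z k n) (pw hk (show 0 < j.1 + 1 by omega))
        simpa [bb] using this
      hbb := fun i j hij => mz (pw hk (by have : i.1 < j.1 := hij; omega))
      hbm := fun j => Nat.mul_le_mul_right _ (pw0 hk (by omega))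
      hcb := fun j => mz (pw hk (by omega))
      hcc := fun i j hij => mz (pw hk (by have : i.1 < j.1 := hij; omega))
      hPc := fun j p => by
        rw [cjq_eq]
        have := rk_pos (k := k) (show p.1.1.1 < p.1.2.1 from p.2)
        exact mz (pw hk (by omega))
      hPb := fun p => by
        rw [cjq_eq]
        have := rk_pos (k := k) (show p.1.1.1 < p.1.2.1 from p.2)
        refine mz ?_
        rw [← pow_add, ← pow_add, ← pow_add]
        exact Nat.pow_le_pow_right (by unfold k0; omega) (by omega)
      hPP := fun p q hpq => by
        simp only [cjq_eq]
        have hp : p.1.1.1 < p.1.2.1 := p.2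
        have hq : q.1.1.1 < q.1.2.1 := q.2
        have hne : ¬ (p.1.1.1 = q.1.1.1 ∧ p.1.2.1 = q.1.2.1) := by
          rintro ⟨h1, h2⟩
          exact hpq (Subtype.ext (Prod.ext (Fin.ext h1) (Fin.ext h2)))
        by_cases hc : p.1.1.1 < q.1.1.1 ∨ (p.1.1.1 = q.1.1.1 ∧ p.1.2.1 < q.1.2.1)
        · have := rk_lt hp p.1.2.2 hq q.1.2.2 hc
          exact Or.inl (mz (pw hk (by omega)))
        · have := rk_lt hq q.1.2.2 hp p.1.2.2 (by omega)
          exact Or.inr (mz (pw hk (by omega)))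
      hvg := fun a => (vg_eq hk hn x hxbd a).1
      hep0 := fun e => rfl
      hep1 := fun e => rfl
      hcut := by
        rw [Finset.card_filter, Finset.card_filter, Finset.card_filter, sumBB]
        simp only [lCf, if_true, Bool.false_eq_true, if_false]
        omega
      hcolU := fun j => hU _ (hcol j)
      hcolL := fun j => hLo _ (hcol j)
      hprU := fun j => hU _ (hpair j)
      hprL := fun j => hLo _ (hpair j) }
  obtain ⟨sel, hs⟩ := D.final hxinj hxna
  have key : ∀ j j' : Fin k, j < j' → M.Adj (j, sel j) (j', sel j') := by
    intro j j' hj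
    obtain ⟨e, h1, h2⟩ := hs ⟨(j, j'), hj⟩
    have h3 : M.Adj (epE (e, false)) (epE (e, true)) := e.2.1
    have h1' : epE (e, false) = (j, sel j) := h1
    have h2' : epE (e, true) = (j', sel j') := h2
    rwa [h1', h2'] at h3
  refine ⟨sel, fun j j' hj => ?_⟩
  rcases lt_or_gt_of_ne hj with h | h
  · exact key _ _ h
  · exact (key _ _ h).symm

end MCC

open MCC

/-- Lemma (converse direction of the reduction): if the instance `I'` has a solution,
then `M` contains a multicolored `k`-clique. -/
theorem statement11
    (k n : ℕ) (hk : 2 ≤ k) (hn : 1 ≤ n)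
    (x : Fin n → ℕ) (hxinj : Function.Injective x) (hxbd : ∀ i, x i ≤ n^4)
    (hxna : ∀ (g : Fin (k-1) → Fin n) (i : Fin n),
      (∑ j, x (g j)) = (k-1) * x i → ∀ j, x (g j) = x i)
    (M : SimpleGraph (Fin k × Fin n)) (hM : ∀ u w, M.Adj u w → u.1 ≠ w.1)
    (hsol : HasSol k n x M) : HasMCClique k n M := by
  exact mainThm k n hk hn x hxinj hxbd hxna M hsol
end

section
/- The instance (T, k, b, s_1, ..., s_b) has a solution if and only if there exists a set of at most k + b − 1 edges of T' whose removal yields connected components that can be assigned to b groups with every group receiving exactly 5n vertices in total. -/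
namespace TP13

/-- A solution cutting at most `kk` edges: `EP` is a set of at most `kk` edges of `T`, and
`lam` assigns the connected components of `T − EP` to the groups (it is constant on each
component) so that each group `g` receives exactly `sizes g` vertices. -/
def IsSolutionLe {V G : Type} (T : SimpleGraph V) (EP : Set (Sym2 V)) (kk : ℕ)
    (sizes : G → ℕ) (lam : V → G) : Prop :=
  EP ⊆ T.edgeSet ∧ EP.ncard ≤ kk ∧
    (∀ v w : V, (T.deleteEdges EP).Reachable v w → lam v = lam w) ∧
    ∀ g : G, {v | lam v = g}.ncard = sizes g

/-- The vertex type of the tree `T'`: the vertices of `T` together with, for each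
`i ∈ {1,…,b}`, a star `S_i` with `5n − s_i` vertices (root `none` and `5n − s_i − 1`
leaves `some _`). -/
abbrev V13 (b n : ℕ) (s : Fin b → ℕ) (V : Type) : Type :=
  V ⊕ (Σ i : Fin b, Option (Fin (5*n - s i - 1)))

/-- The (directed) edge relation of `T'`: the edges of `T`, an edge from the chosen vertex
`r` of `T` to the root `r_i` of each star `S_i`, and the star edges of each `S_i`. -/
def rel13 (b n : ℕ) (s : Fin b → ℕ) {V : Type} (T : SimpleGraph V) (r : V) :
    V13 b n s V → V13 b n s V → Prop
  | Sum.inl u, Sum.inl w => T.Adj u w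
  | Sum.inl u, Sum.inr ⟨_, d⟩ => u = r ∧ d = none
  | Sum.inr ⟨i, d⟩, Sum.inr ⟨i', d'⟩ => i = i' ∧ d = none ∧ d' ≠ none
  | _, _ => False

/-- The tree `T'` obtained from `T` by attaching the roots of the stars `S_1, …, S_b` to `r`. -/
def TG13 (b n : ℕ) (s : Fin b → ℕ) {V : Type} (T : SimpleGraph V) (r : V) :
    SimpleGraph (V13 b n s V) :=
  SimpleGraph.fromRel (rel13 b n s T r)

end TP13

open TP13

namespace TP13

/-- bichromatic edges -/
def bic {V G : Type} (T : SimpleGraph V) (lam : V → G) : Set (Sym2 V) :=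
  {e | e ∈ T.edgeSet ∧ ¬ (e.map lam).IsDiag}

theorem mem_bic {V G : Type} (T : SimpleGraph V) (lam : V → G) (u v : V) :
    s(u, v) ∈ bic T lam ↔ T.Adj u v ∧ lam u ≠ lam v := by
  simp [bic]

theorem sol_iff {V G : Type} [Finite V] (T : SimpleGraph V) (k : ℕ) (s : G → ℕ) :
    (∃ (EP : Set (Sym2 V)) (lam : V → G), IsSolutionLe T EP k s lam) ↔
    ∃ lam : V → G, (bic T lam).ncard ≤ k ∧ ∀ g, {v | lam v = g}.ncard = s g := by
  constructor
  · rintro ⟨EP, lam, h1, h2, h3, h4⟩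
    refine ⟨lam, le_trans (Set.ncard_le_ncard ?_ (Set.toFinite _)) h2, h4⟩
    intro e
    induction e with | _ u v => ?_
    intro he
    rw [mem_bic] at he
    by_contra hc
    apply he.2
    apply h3
    apply SimpleGraph.Adj.reachable
    rw [SimpleGraph.deleteEdges_adj]
    exact ⟨he.1, hc⟩
  · rintro ⟨lam, h1, h2⟩
    refine ⟨bic T lam, lam, fun e he => he.1, h1, ?_, h2⟩
    rintro v w ⟨p⟩
    induction p with
    | nil => rfl
    | cons h p ih =>
      rw [← ih]
      rw [SimpleGraph.deleteEdges_adj, mem_bic] at h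
      by_contra hc
      exact h.2 ⟨h.1, hc⟩

theorem exists_leaf {V : Type} [Finite V] {T : SimpleGraph V} (hT : T.IsTree) (r : V)
    (S : Set V) (hS : S.Nonempty) :
    ∃ u ∈ S, ∃ x, ∀ w ∈ S, T.Adj u w → w = x := by
  obtain ⟨u, hu, hmax⟩ := Set.exists_max_image S (fun v => T.dist r v) (Set.toFinite _) hS
  obtain ⟨p, hp, hpl⟩ := hT.connected.exists_path_of_dist r u
  refine ⟨u, hu, p.penultimate, fun w hw ha => ?_⟩
  have hle := hmax w hw
  by_cases hws : w ∈ p.support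
  · exact hT.isAcyclic.eq_penultimate_of_adj_end hp ha hws
  · exfalso
    obtain ⟨q, hq, hql⟩ := hT.connected.exists_path_of_dist r w
    have hc : (p.concat ha).IsPath := hp.concat hws ha
    have := hT.isAcyclic.path_unique ⟨q, hq⟩ ⟨_, hc⟩
    have h2 : q = p.concat ha := congrArg Subtype.val this
    rw [h2, SimpleGraph.Walk.length_concat] at hql
    omega

theorem ncard_eq_sum {α : Type} [Fintype α] (P : α → Prop) [DecidablePred P] :
    {x | P x}.ncard = ∑ x, if P x then 1 else 0 := by
  rw [Finset.sum_boole, Set.ncard_eq_toFinset_card']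
  simp

theorem sum_fib {V G : Type} [Fintype V] [Fintype G] (lam : V → G) :
    ∑ g, {v | lam v = g}.ncard = Fintype.card V := by
  classical
  simp_rw [ncard_eq_sum]
  rw [Finset.sum_comm]
  simp

theorem bic_update {V G : Type} [Finite V] [DecidableEq V] (T : SimpleGraph V) (lam : V → G)
    (u x : V) (j : G) (hx : ∀ w, lam w = lam u → T.Adj u w → w = x) :
    (bic T (Function.update lam u j)).ncard ≤ (bic T lam).ncard + 1 := by
  refine le_trans (Set.ncard_le_ncard (t := insert s(u, x) (bic T lam)) ?_ (Set.toFinite _))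
    (Set.ncard_insert_le _ _)
  intro e
  induction e with | _ p q => ?_
  intro he
  rw [mem_bic] at he
  rw [Set.mem_insert_iff, mem_bic]
  by_cases hpq : lam p = lam q
  · left
    by_cases hp : p = u
    · subst hp
      rw [hx q hpq.symm he.1]
    · by_cases hq : q = u
      · subst hq
        rw [hx p hpq he.1.symm, Sym2.eq_swap]
      · exact absurd hpq (by simpa [Function.update, hp, hq] using he.2)
  · exact Or.inr ⟨he.1, hpq⟩

theorem fib_update {V G : Type} [Fintype V] [DecidableEq V] [DecidableEq G] (lam : V → G)
    (u : V) (j : G) (hj : lam u ≠ j) (g : G) :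
    {v | Function.update lam u j v = g}.ncard + (if g = lam u then 1 else 0)
     = {v | lam v = g}.ncard + (if g = j then 1 else 0) := by
  rw [ncard_eq_sum, ncard_eq_sum]
  rw [← Finset.sum_erase_add _ _ (Finset.mem_univ u),
    ← Finset.sum_erase_add _ (fun v => if lam v = g then 1 else 0) (Finset.mem_univ u)]
  have : ∑ x ∈ Finset.univ.erase u, (if Function.update lam u j x = g then 1 else 0)
      = ∑ x ∈ Finset.univ.erase u, (if lam x = g then 1 else 0) := by
    apply Finset.sum_congr rfl
    intro x hx
    simp [Function.update, Finset.ne_of_mem_erase hx]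
  rw [this]
  simp only [Function.update_self, eq_comm (a := g)]
  omega

theorem fix {V G : Type} [Fintype V] [Fintype G] {T : SimpleGraph V} (hT : T.IsTree) (r : V)
    (s : G → ℕ) (hs : ∑ g, s g = Fintype.card V) (m : ℕ) :
    ∀ lam : V → G, ∑ g, ({v | lam v = g}.ncard - s g) ≤ m →
    ∃ lam' : V → G, (bic T lam').ncard ≤ (bic T lam).ncard + m ∧
      ∀ g, {v | lam' v = g}.ncard = s g := by
  classical
  induction m with
  | zero =>
    intro lam h
    refine ⟨lam, le_rfl, ?_⟩
    have h0 : ∀ g ∈ Finset.univ, {v | lam v = g}.ncard ≤ s g := by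
      intro g hg
      have := Finset.single_le_sum (f := fun g => {v | lam v = g}.ncard - s g)
        (fun _ _ => Nat.zero_le _) hg
      omega
    have := (Finset.sum_eq_sum_iff_of_le h0).1 (by rw [sum_fib, hs])
    exact fun g => this g (Finset.mem_univ _)
  | succ m ih =>
    intro lam h
    by_cases hall : ∀ g, {v | lam v = g}.ncard = s g
    · exact ⟨lam, by omega, hall⟩
    have hi : ∃ i, s i < {v | lam v = i}.ncard := by
      by_contra hc
      push Not at hc
      have := (Finset.sum_eq_sum_iff_of_le (s := Finset.univ) (fun g _ => hc g)).1
        (by rw [sum_fib, hs])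
      exact hall fun g => this g (Finset.mem_univ _)
    have hj : ∃ j, {v | lam v = j}.ncard < s j := by
      by_contra hc
      push Not at hc
      have := (Finset.sum_eq_sum_iff_of_le (s := Finset.univ) (fun g _ => hc g)).1
        (by rw [sum_fib, hs])
      exact hall fun g => (this g (Finset.mem_univ _)).symm
    obtain ⟨i, hi⟩ := hi
    obtain ⟨j, hj⟩ := hj
    have hne : {v | lam v = i}.Nonempty := by
      rw [← Set.ncard_pos]; omega
    obtain ⟨u, hu, x, hx⟩ := exists_leaf hT r _ hne
    simp only [Set.mem_setOf_eq] at hu hx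
    have hij : lam u ≠ j := by
      rintro rfl
      rw [hu] at hj
      omega
    have hb := bic_update T lam u x j (by rw [hu]; exact hx)
    have hf := fib_update lam u j hij
    obtain ⟨lam', h1, h2⟩ := ih (Function.update lam u j) (by
      have : ∑ g, ({v | Function.update lam u j v = g}.ncard - s g)
        < ∑ g, ({v | lam v = g}.ncard - s g) := by
        apply Finset.sum_lt_sum
        · intro g _
          have := hf g
          by_cases hg : g = j
          · subst hg
            simp only [if_true] at this
            split_ifs at this <;> omega
          · simp only [hg, if_false] at this
            omega
        · refine ⟨i, Finset.mem_univ _, ?_⟩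
          have := hf i
          rw [hu] at this hij
          simp only [if_true, hij, if_false] at this
          omega
      omega)
    exact ⟨lam', by omega, h2⟩

/-- parent of a star vertex -/
def par (b n : ℕ) (s : Fin b → ℕ) {V : Type} (r : V) :
    (Σ i : Fin b, Option (Fin (5*n - s i - 1))) → V13 b n s V
  | ⟨_, none⟩ => Sum.inl r
  | ⟨i, some _⟩ => Sum.inr ⟨i, none⟩

theorem adj_ll (b n : ℕ) (s : Fin b → ℕ) {V : Type} (T : SimpleGraph V) (r u w : V) :
    (TG13 b n s T r).Adj (Sum.inl u) (Sum.inl w) ↔ T.Adj u w := by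
  simp only [TG13, SimpleGraph.fromRel_adj, rel13]
  constructor
  · rintro ⟨_, h | h⟩
    exacts [h, h.symm]
  · intro h
    exact ⟨by simpa using h.ne, Or.inl h⟩

theorem adj_lr (b n : ℕ) (s : Fin b → ℕ) {V : Type} (T : SimpleGraph V) (r u : V) (x) :
    (TG13 b n s T r).Adj (Sum.inl u) (Sum.inr x) ↔ par b n s r x = Sum.inl u := by
  obtain ⟨i, _ | d⟩ := x <;> simp [TG13, SimpleGraph.fromRel_adj, rel13, par, eq_comm]

theorem adj_rr (b n : ℕ) (s : Fin b → ℕ) {V : Type} (T : SimpleGraph V) (r : V) (x y) :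
    (TG13 b n s T r).Adj (Sum.inr x) (Sum.inr y) ↔
      par b n s r x = Sum.inr y ∨ par b n s r y = Sum.inr x := by
  obtain ⟨i, _ | d⟩ := x <;> obtain ⟨j, _ | e⟩ := y <;>
    simp [TG13, SimpleGraph.fromRel_adj, rel13, par]
  · constructor
    · rintro ⟨_, rfl⟩; simp
    · intro h
      have := h.1
      subst this
      simp
  · constructor
    · rintro ⟨_, rfl⟩; simp
    · intro h
      have := h.1
      subst this
      simp
  · constructor
    · rintro rfl; simp
    · rintro rfl; simp

theorem adj_par (b n : ℕ) (s : Fin b → ℕ) {V : Type} (T : SimpleGraph V) (r : V) (x) :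
    (TG13 b n s T r).Adj (Sum.inr x) (par b n s r x) := by
  cases h : par b n s r x with
  | inl u => exact ((adj_lr ..).2 h).symm
  | inr y => exact (adj_rr ..).2 (Or.inl h)

theorem par_inj (b n : ℕ) (s : Fin b → ℕ) {V : Type} (r : V) :
    Function.Injective (fun x => s((Sum.inr x : V13 b n s V), par b n s r x)) := by
  intro x y h
  simp only [Sym2.eq_iff] at h
  rcases h with h | h
  · exact Sum.inr_injective h.1
  · obtain ⟨i, _ | d⟩ := x <;> obtain ⟨j, _ | e⟩ := y <;> simp [par] at h
    have := h.1.1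
    subst this
    simp at h

theorem bic_card (b n : ℕ) (s : Fin b → ℕ) {V : Type} [Finite V] (T : SimpleGraph V) (r : V)
    {G : Type} (lam : V13 b n s V → G) :
    (bic (TG13 b n s T r) lam).ncard = (bic T (fun v => lam (Sum.inl v))).ncard +
      {x | lam (Sum.inr x) ≠ lam (par b n s r x)}.ncard := by
  have : bic (TG13 b n s T r) lam = Sym2.map Sum.inl '' bic T (fun v => lam (Sum.inl v)) ∪
      (fun x => s(Sum.inr x, par b n s r x)) '' {x | lam (Sum.inr x) ≠ lam (par b n s r x)} := by
    apply Set.Subset.antisymm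
    · intro e
      induction e with | _ p q => ?_
      rw [mem_bic]
      rintro ⟨h1, h2⟩
      rcases p with u | x <;> rcases q with w | y
      · left
        exact ⟨s(u, w), (mem_bic ..).2 ⟨(adj_ll ..).1 h1, h2⟩, rfl⟩
      · right
        rw [adj_lr] at h1
        refine ⟨y, ?_, ?_⟩
        · simpa [h1] using h2.symm
        · simp [h1]
      · right
        replace h1 := h1.symm
        rw [adj_lr] at h1
        refine ⟨x, ?_, ?_⟩
        · simpa [h1] using h2
        · simp [h1]
      · right
        rw [adj_rr] at h1
        rcases h1 with h1 | h1
        · refine ⟨x, ?_, ?_⟩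
          · simpa [h1] using h2
          · simp [h1]
        · refine ⟨y, ?_, ?_⟩
          · simpa [h1] using h2.symm
          · simp [h1]
    · rintro e (⟨e, he, rfl⟩ | ⟨x, hx, rfl⟩)
      · induction e with | _ p q => ?_
        rw [mem_bic] at he
        exact (mem_bic ..).2 ⟨(adj_ll ..).2 he.1, he.2⟩
      · exact (mem_bic ..).2 ⟨adj_par .., hx⟩
  rw [this, Set.ncard_union_eq _ (Set.toFinite _) (Set.toFinite _),
    Set.ncard_image_of_injective _ (Sym2.map.injective Sum.inl_injective),
    Set.ncard_image_of_injective _ (par_inj ..)]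
  rw [Set.disjoint_left]
  rintro _ ⟨e, he, rfl⟩ ⟨x, hx, h⟩
  induction e with | _ p q => ?_
  simp at h

theorem exists_fib {V : Type} [Fintype V] {b : ℕ} (s : Fin b → ℕ)
    (hs : ∑ g, s g = Fintype.card V) : ∃ lam : V → Fin b, ∀ g, {v | lam v = g}.ncard = s g := by
  classical
  have hc : Fintype.card V = Fintype.card (Σ g, Fin (s g)) := by simp [hs]
  let e := Fintype.equivOfCardEq hc
  refine ⟨fun v => (e v).1, fun g => ?_⟩
  rw [ncard_eq_sum, Equiv.sum_comp e (fun x => if x.1 = g then 1 else 0), Fintype.sum_sigma]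
  rw [Finset.sum_eq_single g]
  · simp
  · intro x _ hx
    simp [hx]
  · simp

theorem bic_le {V G : Type} [Fintype V] {T : SimpleGraph V} (hT : T.IsTree) (lam : V → G) :
    (bic T lam).ncard + 1 ≤ Fintype.card V := by
  classical
  rw [← hT.card_edgeFinset, ← Set.ncard_coe_finset]
  gcongr
  · exact Set.toFinite _
  · intro e he
    simpa using he.1

theorem fwd {V : Type} [Fintype V] {T : SimpleGraph V}
    {k b : ℕ} (s : Fin b → ℕ)
    (hsum : ∑ i, s i = Fintype.card V) (r : V) (lam : V → Fin b) (h : (bic T lam).ncard ≤ k)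
    (hf : ∀ g, {v | lam v = g}.ncard = s g) :
    ∃ lam : V13 b (Fintype.card V) s V → Fin b,
      (bic (TG13 b (Fintype.card V) s T r) lam).ncard ≤ k + b - 1 ∧
      ∀ g, {v | lam v = g}.ncard = 5 * Fintype.card V := by
  classical
  have hn : 0 < Fintype.card V := Fintype.card_pos_iff.2 ⟨r⟩
  refine ⟨Sum.elim lam (·.1), ?_, fun g => ?_⟩
  · rw [bic_card, ncard_eq_sum, Fintype.sum_sigma]
    simp only [Sum.elim_inl, Sum.elim_inr, Fintype.sum_option, par]
    have : ∑ i, (if i ≠ lam r then 1 else 0) + 1 = b := by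
      have : ∑ i : Fin b, ((if i ≠ lam r then 1 else 0) + if i = lam r then 1 else 0) = b := by
        rw [Finset.sum_congr rfl (g := fun _ => 1)]
        · simp
        · intro i _; by_cases h : i = lam r <;> simp [h]
      rw [Finset.sum_add_distrib] at this
      simpa using this
    have h2 : ∑ i : Fin b, ((if i ≠ lam r then 1 else 0) +
        ∑ _o : Fin (5 * Fintype.card V - s i - 1), (if i ≠ i then 1 else 0))
        = ∑ i, (if i ≠ lam r then 1 else 0) := by
      apply Finset.sum_congr rfl
      intro i _
      simp
    have h3 : (bic T fun v => lam v).ncard ≤ k := h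
    refine le_trans (Nat.add_le_add h3 (le_of_eq h2)) ?_
    omega
  · rw [ncard_eq_sum, Fintype.sum_sum_type, Fintype.sum_sigma]
    have h1 := hf g
    rw [ncard_eq_sum] at h1
    have : s g ≤ Fintype.card V := by
      rw [← hsum]
      exact Finset.single_le_sum (f := s) (fun _ _ => Nat.zero_le _) (Finset.mem_univ g)
    have h2 : ∑ i : Fin b, ∑ _o : Option (Fin (5 * Fintype.card V - s i - 1)),
        (if i = g then 1 else 0) = 5 * Fintype.card V - s g := by
      rw [Finset.sum_eq_single g]
      · simp
        omega
      · intro x _ hx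
        simp [hx]
      · simp
    refine (congrArg₂ (· + ·) h1 h2).trans ?_
    omega

theorem bwd {V : Type} [Fintype V] {T : SimpleGraph V} (hT : T.IsTree)
    {k b : ℕ} (hb : b ≤ k + 1) (s : Fin b → ℕ)
    (n : ℕ) (hn : n = Fintype.card V) (hsum : ∑ i, s i = n) (r : V)
    (lam : V13 b (n) s V → Fin b)
    (h : (bic (TG13 b (n) s T r) lam).ncard ≤ k + b - 1)
    (hf : ∀ g, {v | lam v = g}.ncard = 5 * n) :
    ∃ lam : V → Fin b, (bic T lam).ncard ≤ k ∧ ∀ g, {v | lam v = g}.ncard = s g := by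
  classical
  by_cases hk : n ≤ k + 1
  · obtain ⟨l, hl⟩ := exists_fib s (hsum.trans hn)
    have := bic_le hT l
    exact ⟨l, by omega, hl⟩
  have hb0 : 0 < b := (lam (Sum.inl r)).pos
  have hsn : ∀ g, s g ≤ n := fun g => by
    rw [← hsum]
    exact Finset.single_le_sum (f := s) (fun _ _ => Nat.zero_le _) (Finset.mem_univ g)
  have hsn2 : ∀ g g', g ≠ g' → s g + s g' ≤ n := fun g g' hg => by
    rw [← hsum, ← Finset.sum_pair hg]
    exact Finset.sum_le_sum_of_subset (Finset.subset_univ _)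
  let a : Fin b → Fin b := fun i => lam (Sum.inr ⟨i, none⟩)
  let C : Fin b → ℕ := fun i =>
    ∑ o : Fin (5 * n - s i - 1), if lam (Sum.inr ⟨i, some o⟩) ≠ a i then 1 else 0
  let K : Fin b → Fin b → ℕ := fun i g =>
    ∑ o : Option (Fin (5 * n - s i - 1)), if lam (Sum.inr ⟨i, o⟩) = g then 1 else 0
  have hKC : ∀ i, K i (a i) + C i = 5 * n - s i := by
    intro i
    have : ∑ o : Fin (5 * n - s i - 1), ((if lam (Sum.inr ⟨i, some o⟩) = a i then 1 else 0)
      + if lam (Sum.inr ⟨i, some o⟩) ≠ a i then 1 else 0) = 5 * n - s i - 1 := by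
        rw [Finset.sum_congr rfl (g := fun _ => 1)]
        · simp
        · intro o _; by_cases h : lam (Sum.inr ⟨i, some o⟩) = a i <;> simp [h]
    rw [Finset.sum_add_distrib] at this
    have h2 := hsn i
    simp only [K, C, Fintype.sum_option]
    rw [if_pos rfl]
    omega
  have hfib : ∀ g, {v | lam (Sum.inl v) = g}.ncard + ∑ i, K i g = 5 * n := by
    intro g
    have := hf g
    rw [ncard_eq_sum, Fintype.sum_sum_type, Fintype.sum_sigma] at this
    rw [ncard_eq_sum]
    exact this
  have hN : {x | lam (Sum.inr x) ≠ lam (par b n s r x)}.ncard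
      = ∑ i, (if a i ≠ lam (Sum.inl r) then 1 else 0) + ∑ i, C i := by
    rw [ncard_eq_sum, Fintype.sum_sigma, ← Finset.sum_add_distrib]
    simp only [Fintype.sum_option]
    rfl
  rw [bic_card, hN] at h
  have hCs : ∀ i j, i ≠ j → C i + C j ≤ ∑ i, C i := fun i j hg => by
    rw [← Finset.sum_pair hg]
    exact Finset.sum_le_sum_of_subset (Finset.subset_univ _)
  have ha : Function.Injective a := by
    intro i j hij
    by_contra hne
    have h1 := hKC i
    have h2 := hKC j
    have h3 := hCs i j hne
    have h4 := hfib (a i)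
    have h5 : K i (a i) + K j (a i) ≤ ∑ i', K i' (a i) := by
      rw [← Finset.sum_pair (f := fun i' => K i' (a i)) hne]
      exact Finset.sum_le_sum_of_subset (Finset.subset_univ _)
    rw [← hij] at h2
    have h6 := hsn2 i j hne
    omega
  have hbij : Function.Bijective a := Finite.injective_iff_bijective.1 ha
  let e : Fin b ≃ Fin b := Equiv.ofBijective a hbij
  have hR : ∑ i, (if a i ≠ lam (Sum.inl r) then 1 else 0) + 1 = b := by
    have : ∑ i : Fin b, ((if a i ≠ lam (Sum.inl r) then 1 else 0) +
        if a i = lam (Sum.inl r) then 1 else 0) = b := by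
      rw [Finset.sum_congr rfl (g := fun _ => 1)]
      · simp
      · intro i _; by_cases h : a i = lam (Sum.inl r) <;> simp [h]
    rw [Finset.sum_add_distrib] at this
    have h2 : ∑ i : Fin b, (if a i = lam (Sum.inl r) then 1 else 0) = 1 := by
      have := Equiv.sum_comp e (fun i => if i = lam (Sum.inl r) then 1 else 0)
      simp only [Finset.sum_ite_eq', Finset.mem_univ, if_true, Finset.sum_ite_eq] at this
      exact this
    omega
  obtain ⟨l, h1, h2⟩ := fix hT r s (hsum.trans hn) (∑ i, C i) (fun v => e.symm (lam (Sum.inl v))) (by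
    apply Finset.sum_le_sum
    intro g _
    have h1 := hfib (a g)
    have h2 := hKC g
    have h3 : K g (a g) ≤ ∑ i, K i (a g) :=
      Finset.single_le_sum (f := fun i => K i (a g)) (fun _ _ => Nat.zero_le _)
        (Finset.mem_univ g)
    have h4 : {v | e.symm (lam (Sum.inl v)) = g} = {v | lam (Sum.inl v) = a g} := by
      ext v
      simp only [Set.mem_setOf_eq, Equiv.symm_apply_eq]
      rfl
    rw [h4]
    have := hsn g
    omega)
  refine ⟨l, ?_, h2⟩
  have h3 : bic T (fun v => e.symm (lam (Sum.inl v))) = bic T (fun v => lam (Sum.inl v)) := by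
    ext x
    induction x with | _ p q => ?_
    simp [mem_bic]
  rw [h3] at h1
  omega

end TP13

/-- The instance `(T, k, b, s_1, …, s_b)` of Tree Partitioning has a solution if and only if
at most `k + b − 1` edges can be removed from `T'` so that the resulting components can be
grouped into `b` groups each receiving exactly `5n` vertices. -/
theorem statement13
    (V : Type) [Fintype V] (T : SimpleGraph V) (hT : T.IsTree)
    (k b : ℕ) (hb : b ≤ k + 1) (s : Fin b → ℕ)
    (hsum : ∑ i, s i = Fintype.card V) (r : V) :
    (∃ (EP : Set (Sym2 V)) (lam : V → Fin b), IsSolutionLe T EP k s lam) ↔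
    (∃ (EP : Set (Sym2 (V13 b (Fintype.card V) s V)))
        (lam : V13 b (Fintype.card V) s V → Fin b),
      IsSolutionLe (TG13 b (Fintype.card V) s T r) EP (k + b - 1)
        (fun _ : Fin b => 5 * Fintype.card V) lam) := by
  rw [sol_iff, sol_iff]
  constructor
  · rintro ⟨lam, h1, h2⟩
    exact fwd s hsum r lam h1 h2
  · rintro ⟨lam, h1, h2⟩
    exact bwd hT hb s _ rfl hsum r lam h1 h2
end

section
/- Let F be a finite rooted tree with root v, let u be a child of v, let F_u be the subtree of F rooted at u, and let F⁻ be the rooted tree (with root v) obtained from F by deleting all vertices of F_u. Fix b ≥ 1. Then for all k', s ∈ ℕ and every multiset X of b natural numbers, (k', X, s) is realizable in F if and only if at least one of the following holds: (i) there exist k_1, k_2 with k_1 + k_2 + 1 = k', an integer s_1 ∈ ℕ, multisets Y, Z of b natural numbers, and an element j of X with j ≥ s_1, such that (k_1, Y, s_1) is realizable in F_u, (k_2, Z, s) is realizable in F⁻, and X' = Y ◇ Z, where X' is obtained from X by replacing one occurrence of j by j − s_1; (ii) there exist k_1, k_2 with k_1 + k_2 = k', integers s_1, s_2 with s_1 +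 s_2 = s, and multisets Y, Z of b natural numbers such that (k_1, Y, s_1) is realizable in F_u, (k_2, Z, s_2) is realizable in F⁻, and X = Y ◇ Z. -/
/-- `X = Y ◇ Z`: there are enumerations (as lists) of the multisets `Y` and `Z` whose
pointwise sums enumerate `X`. -/
def DiamondEq (X Y Z : Multiset ℕ) : Prop :=
  ∃ ly lz : List ℕ, (ly : Multiset ℕ) = Y ∧ (lz : Multiset ℕ) = Z ∧
    ((List.zipWith (· + ·) ly lz : List ℕ) : Multiset ℕ) = X

/-- `(k', X, s)` is realizable in the rooted tree `(G, ρ)`: there is a set `C` of exactly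
`k'` edges of `G` such that the component of `G − C` containing the root `ρ` has exactly `s`
vertices, and the remaining components can be assigned (via `lam`, constant on components)
to `b` possibly empty groups whose multiset of total vertex counts is `X`. -/
def Realizable {V : Type} (G : SimpleGraph V) (ρ : V) (b kk s : ℕ) (X : Multiset ℕ) : Prop :=
  ∃ (C : Set (Sym2 V)) (lam : V → Fin b),
    C ⊆ G.edgeSet ∧ C.ncard = kk ∧
    {w | (G.deleteEdges C).Reachable ρ w}.ncard = s ∧
    (∀ v w : V, (G.deleteEdges C).Reachable v w → lam v = lam w) ∧
    Multiset.map
      (fun g => {w | lam w = g ∧ ¬ (G.deleteEdges C).Reachable ρ w}.ncard)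
      (Finset.univ.val : Multiset (Fin b)) = X

/-- functional version of realizability -/
def RealF {V : Type} (G : SimpleGraph V) (ρ : V) (b kk s : ℕ) (g0 : Option (Fin b)) (n : Fin b → ℕ) : Prop :=
  ∃ (C : Set (Sym2 V)) (lam : V → Fin b),
    C ⊆ G.edgeSet ∧ C.ncard = kk ∧
    {w | (G.deleteEdges C).Reachable ρ w}.ncard = s ∧
    (∀ v w : V, (G.deleteEdges C).Reachable v w → lam v = lam w) ∧
    (∀ g, {w | lam w = g ∧ ¬ (G.deleteEdges C).Reachable ρ w}.ncard = n g) ∧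
    (∀ g ∈ g0, lam ρ = g)

theorem realizable_iff {V : Type} (G : SimpleGraph V) (ρ : V) (b kk s : ℕ) (X : Multiset ℕ) :
    Realizable G ρ b kk s X ↔ ∃ n : Fin b → ℕ, RealF G ρ b kk s none n ∧
      Multiset.map n Finset.univ.val = X := by
  constructor
  · rintro ⟨C, lam, h1, h2, h3, h4, h5⟩
    exact ⟨_, ⟨C, lam, h1, h2, h3, h4, fun g => rfl, by simp⟩, h5⟩
  · rintro ⟨n, ⟨C, lam, h1, h2, h3, h4, h5, -⟩, h6⟩
    refine ⟨C, lam, h1, h2, h3, h4, ?_⟩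
    rw [← h6]
    congr 1
    funext g
    exact h5 g

theorem RealF.normalize {V : Type} {G : SimpleGraph V} {ρ : V} {b kk s : ℕ} {n : Fin b → ℕ} {o}
    (h : RealF G ρ b kk s o n) (g0 : Fin b) : RealF G ρ b kk s (some g0) n := by
  classical
  obtain ⟨C, lam, h1, h2, h3, h4, h5, -⟩ := h
  refine ⟨C, fun w => if (G.deleteEdges C).Reachable ρ w then g0 else lam w, h1, h2, h3, ?_, ?_, ?_⟩
  · intro x y hxy
    have : (G.deleteEdges C).Reachable ρ x ↔ (G.deleteEdges C).Reachable ρ y :=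
      ⟨fun h => h.trans hxy, fun h => h.trans hxy.symm⟩
    simp only [this, h4 x y hxy]
  · intro g
    rw [← h5 g]
    congr 1
    ext w
    by_cases hw : (G.deleteEdges C).Reachable ρ w <;> simp [hw]
  · simp

theorem RealF.perm {V : Type} {G : SimpleGraph V} {ρ : V} {b kk s : ℕ} {n : Fin b → ℕ}
    (h : RealF G ρ b kk s none n) (σ : Equiv.Perm (Fin b)) : RealF G ρ b kk s none (n ∘ σ) := by
  obtain ⟨C, lam, h1, h2, h3, h4, h5, -⟩ := h
  refine ⟨C, fun w => σ.symm (lam w), h1, h2, h3, ?_, ?_, by simp⟩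
  · intro x y hxy
    simp only [h4 x y hxy]
  · intro g
    simp only [Function.comp, ← h5, Equiv.symm_apply_eq]

theorem exists_perm_of_map {b : ℕ} (n m : Fin b → ℕ)
    (h : Multiset.map n Finset.univ.val = Multiset.map m Finset.univ.val) :
    ∃ σ : Equiv.Perm (Fin b), n = m ∘ σ := by
  classical
  have key : ∀ c : ℕ, Nonempty ({a // n a = c} ≃ {a // m a = c}) := by
    intro c
    rw [← Fintype.card_eq]
    have := congrArg (Multiset.count c) h
    rw [Multiset.count_map, Multiset.count_map] at this
    rw [Fintype.card_subtype, Fintype.card_subtype]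
    simp only [eq_comm (a := c)] at this
    exact this
  refine ⟨Equiv.ofFiberEquiv (fun c => (key c).some), ?_⟩
  funext a
  exact (Equiv.ofFiberEquiv_map (fun c => (key c).some) a).symm

theorem realF_of_map {V : Type} {G : SimpleGraph V} {ρ : V} {b kk s : ℕ} {n : Fin b → ℕ}
    (h : Realizable G ρ b kk s (Multiset.map n Finset.univ.val)) : RealF G ρ b kk s none n := by
  obtain ⟨m, hm, he⟩ := (realizable_iff ..).1 h
  obtain ⟨σ, hσ⟩ := exists_perm_of_map _ _ he.symm
  rw [hσ]
  exact hm.perm σ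

theorem diamond_iff (b : ℕ) (X Y Z : Multiset ℕ) (hY : Multiset.card Y = b)
    (hZ : Multiset.card Z = b) : DiamondEq X Y Z ↔
    ∃ n1 n2 : Fin b → ℕ, Multiset.map n1 Finset.univ.val = Y ∧ Multiset.map n2 Finset.univ.val = Z ∧
      Multiset.map (n1 + n2) Finset.univ.val = X := by
  have key : ∀ n : Fin b → ℕ, Multiset.map n Finset.univ.val = ((List.ofFn n : List ℕ) : Multiset ℕ) := by
    intro n
    rw [List.ofFn_eq_map]; rfl
  have key2 : ∀ n m : Fin b → ℕ, List.zipWith (· + ·) (List.ofFn n) (List.ofFn m) = List.ofFn (n + m) := by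
    intro n m
    apply List.ext_getElem
    · simp
    · intro i h1 h2
      simp
  constructor
  · rintro ⟨ly, lz, rfl, rfl, rfl⟩
    simp only [Multiset.coe_card] at hY hZ
    have e1 : ly = List.ofFn (fun i : Fin b => ly[i.1]'(by omega)) := by
      apply List.ext_getElem <;> simp [hY]
    have e2 : lz = List.ofFn (fun i : Fin b => lz[i.1]'(by omega)) := by
      apply List.ext_getElem <;> simp [hZ]
    refine ⟨fun i => ly[i.1]'(by omega), fun i => lz[i.1]'(by omega), ?_, ?_, ?_⟩
    · rw [key, ← e1]
    · rw [key, ← e2]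
    · rw [key, ← key2, ← e1, ← e2]
  · rintro ⟨n1, n2, rfl, rfl, rfl⟩
    exact ⟨List.ofFn n1, List.ofFn n2, (key _).symm, (key _).symm, by rw [key2, key]⟩

theorem map_split {b : ℕ} (m : Fin b → ℕ) (g : Fin b) :
    Multiset.map m Finset.univ.val = m g ::ₘ Multiset.map m (Finset.univ.erase g).val := by
  rw [← Multiset.map_cons, Finset.erase_val, Multiset.cons_erase (by simp)]

theorem map_single {b : ℕ} (m : Fin b → ℕ) (g : Fin b) (s : ℕ) :
    Multiset.map (m + Pi.single g s) Finset.univ.val =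
      (m g + s) ::ₘ Multiset.map m (Finset.univ.erase g).val := by
  rw [map_split _ g]
  congr 1
  · simp
  · apply Multiset.map_congr rfl
    intro x hx
    have : x ≠ g := by
      have : x ∈ Finset.univ.erase g := hx
      simpa using this
    simp [this]

theorem replace_iff {b : ℕ} (m : Fin b → ℕ) (X : Multiset ℕ) (s : ℕ) :
    (∃ j ∈ X, s ≤ j ∧ Multiset.map m Finset.univ.val = (j - s) ::ₘ X.erase j) ↔
    ∃ g, Multiset.map (m + Pi.single g s) Finset.univ.val = X := by
  constructor
  · rintro ⟨j, hj, hs, he⟩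
    have : j - s ∈ Multiset.map m Finset.univ.val := by rw [he]; simp
    obtain ⟨g, -, hg⟩ := Multiset.mem_map.1 this
    refine ⟨g, ?_⟩
    rw [map_split m g, hg, Multiset.cons_inj_right] at he
    rw [map_single, he, hg, Nat.sub_add_cancel hs, Multiset.cons_erase hj]
  · rintro ⟨g, rfl⟩
    refine ⟨m g + s, ?_, by omega, ?_⟩
    · rw [map_single]; simp
    · rw [map_single, map_split m g]; simp

theorem reach_retract {V : Type} (H : SimpleGraph V) (S : Set V) [DecidablePred (· ∈ S)] (u : V) (hu : u ∈ S)
    (h : ∀ x ∈ S, ∀ y ∉ S, H.Adj x y → x = u) {x y : V} (hxy : H.Reachable x y) :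
    (H.induce S).Reachable (if hx : x ∈ S then ⟨x, hx⟩ else ⟨u, hu⟩)
      (if hy : y ∈ S then ⟨y, hy⟩ else ⟨u, hu⟩) := by
  obtain ⟨p⟩ := hxy
  induction p with
  | nil => exact SimpleGraph.Reachable.refl _
  | @cons a b c hab p ih =>
    refine SimpleGraph.Reachable.trans ?_ ih
    by_cases ha : a ∈ S <;> by_cases hb : b ∈ S <;> simp only [ha, hb, dif_pos, dif_neg, not_false_eq_true]
    · apply SimpleGraph.Adj.reachable
      simpa using hab
    · have := h a ha b hb hab
      subst this
      exact SimpleGraph.Reachable.refl _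
    · have := h b hb a ha hab.symm
      subst this
      exact SimpleGraph.Reachable.refl _
    · exact SimpleGraph.Reachable.refl _

theorem reach_in {V : Type} (H : SimpleGraph V) (S : Set V) (u : V) (hu : u ∈ S)
    (h : ∀ x ∈ S, ∀ y ∉ S, H.Adj x y → x = u) (x y : S) :
    (H.induce S).Reachable x y ↔ H.Reachable x y := by
  classical
  constructor
  · intro hr
    exact hr.map (SimpleGraph.Embedding.induce S).toHom
  · intro hr
    simpa using reach_retract H S u hu h hr

theorem reach_out {V : Type} (H : SimpleGraph V) (S : Set V) (u : V) (hu : u ∈ S)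
    (h : ∀ x ∈ S, ∀ y ∉ S, H.Adj x y → x = u) (x y : V) (hx : x ∈ S) (hy : y ∉ S)
    (hr : H.Reachable x y) : H.Reachable x u := by
  classical
  have := reach_retract H S u hu h hr
  simp only [hx, hy, dif_pos, dif_neg, not_false_eq_true] at this
  exact (reach_in H S u hu h ⟨x, hx⟩ ⟨u, hu⟩).1 this

theorem reach_nocross {V : Type} (H : SimpleGraph V) (S : Set V)
    (h : ∀ x ∈ S, ∀ y ∉ S, ¬ H.Adj x y) {x y : V} (hxy : H.Reachable x y) : x ∈ S ↔ y ∈ S := by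
  obtain ⟨p⟩ := hxy
  induction p with
  | nil => rfl
  | @cons a b c hab p ih =>
    rw [← ih]
    constructor
    · intro ha; by_contra hb; exact h a ha b hb hab
    · intro hb; by_contra ha; exact h b hb a ha hab.symm

theorem ncard_split {V : Type} [Finite V] (S T : Set V) (hT : ∀ w, w ∈ T ↔ w ∉ S) (P : V → Prop) :
    {w | P w}.ncard = {w : S | P w}.ncard + {w : T | P w}.ncard := by
  rw [← Set.ncard_image_of_injective {w : S | P w} Subtype.val_injective,
    ← Set.ncard_image_of_injective {w : T | P w} Subtype.val_injective, ← Set.ncard_union_eq]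
  · congr 1
    ext w
    by_cases hw : w ∈ S <;> simp [hT, hw]
  · rw [Set.disjoint_left]
    rintro _ ⟨a, -, rfl⟩ ⟨c, -, hc⟩
    have := (hT _).1 c.2
    rw [hc] at this
    exact this a.2
  
theorem edge_split {V : Type} [Finite V] (F : SimpleGraph V) (S T : Set V) (hT : ∀ w, w ∈ T ↔ w ∉ S)
    (u v : V) (hu : u ∈ S) (hv : v ∈ T)
    (h : ∀ x ∈ S, ∀ y ∈ T, F.Adj x y → x = u ∧ y = v) (C : Set (Sym2 V)) (hC : C ⊆ F.edgeSet) :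
    C.ncard = (Sym2.map (Subtype.val : S → V) ⁻¹' C).ncard +
      (Sym2.map (Subtype.val : T → V) ⁻¹' C).ncard + (C ∩ {s(v, u)}).ncard := by
  rw [← Set.ncard_image_of_injective _ (Sym2.map.injective (Subtype.val_injective (p := (· ∈ S)))),
    ← Set.ncard_image_of_injective _ (Sym2.map.injective (Subtype.val_injective (p := (· ∈ T)))),
    ← Set.ncard_union_eq, ← Set.ncard_union_eq]
  · congr 1
    ext e
    constructor
    · intro he
      induction e with | _ x y => ?_
      have ha : F.Adj x y := hC he
      by_cases hx : x ∈ S <;> by_cases hy : y ∈ S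
      · exact Or.inl (Or.inl ⟨s(⟨x, hx⟩, ⟨y, hy⟩), by simpa using he, by simp⟩)
      · obtain ⟨rfl, rfl⟩ := h x hx y ((hT y).2 hy) ha
        exact Or.inr ⟨he, by simp [Sym2.eq_swap]⟩
      · obtain ⟨rfl, rfl⟩ := h y hy x ((hT x).2 hx) ha.symm
        exact Or.inr ⟨he, by simp⟩
      · exact Or.inl (Or.inr ⟨s(⟨x, (hT x).2 hx⟩, ⟨y, (hT y).2 hy⟩), by simpa using he, by simp⟩)
    · rintro ((⟨e, he, rfl⟩ | ⟨e, he, rfl⟩) | ⟨he, -⟩)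
      · exact he
      · exact he
      · exact he
  · rw [Set.disjoint_left]
    rintro _ (⟨e, -, rfl⟩ | ⟨e, -, rfl⟩) ⟨-, he⟩
    · induction e with | _ x y => ?_
      have hvS := (hT v).1 hv
      have hx := x.2
      have hy := y.2
      simp at he
      grind
    · induction e with | _ x y => ?_
      have hx := (hT _).1 x.2
      have hy := (hT _).1 y.2
      simp at he
      grind
  · rw [Set.disjoint_left]
    rintro _ ⟨e, -, rfl⟩ ⟨f, -, hf⟩
    induction e with | _ x y => ?_
    induction f with | _ a c => ?_
    have hx := (hT _).1 a.2
    have hx := (hT _).1 c.2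
    have := x.2
    have := y.2
    simp at hf
    grind

theorem induce_del {V : Type} (F : SimpleGraph V) (S : Set V) (C : Set (Sym2 V)) :
    (F.induce S).deleteEdges (Sym2.map (Subtype.val : S → V) ⁻¹' C) = (F.deleteEdges C).induce S := by
  ext x y
  simp

theorem reach_all {V : Type} [Finite V] (F : SimpleGraph V) (S T : Set V) (hT : ∀ w, w ∈ T ↔ w ∉ S)
    (u v : V) (hu : u ∈ S) (hv : v ∈ T) (hadj : F.Adj v u)
    (h : ∀ x ∈ S, ∀ y ∈ T, F.Adj x y → x = u ∧ y = v) (C : Set (Sym2 V)) :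
    (∀ x y : S, ((F.induce S).deleteEdges (Sym2.map (Subtype.val : S → V) ⁻¹' C)).Reachable x y ↔
      (F.deleteEdges C).Reachable x y) ∧
    (∀ x y : T, ((F.induce T).deleteEdges (Sym2.map (Subtype.val : T → V) ⁻¹' C)).Reachable x y ↔
      (F.deleteEdges C).Reachable x y) ∧
    (∀ x : S, ∀ y : T, (F.deleteEdges C).Reachable x y ↔
      s(v, u) ∉ C ∧ (F.deleteEdges C).Reachable x u ∧ (F.deleteEdges C).Reachable v y) := by
  have h1 : ∀ x ∈ S, ∀ y ∉ S, (F.deleteEdges C).Adj x y → x = u := by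
    intro x hx y hy ha
    exact (h x hx y ((hT y).2 hy) (SimpleGraph.deleteEdges_le _ ha)).1
  have h2 : ∀ x ∈ T, ∀ y ∉ T, (F.deleteEdges C).Adj x y → x = v := by
    intro x hx y hy ha
    have hy : y ∈ S := by
      by_contra h'
      exact hy ((hT y).2 h')
    exact (h y hy x hx (SimpleGraph.deleteEdges_le _ ha).symm).2
  refine ⟨?_, ?_, ?_⟩
  · intro x y
    rw [induce_del]
    exact reach_in _ S u hu h1 x y
  · intro x y
    rw [induce_del]
    exact reach_in _ T v hv h2 x y
  · intro x y
    constructor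
    · intro hr
      refine ⟨?_, ?_, ?_⟩
      · intro hc
        have := reach_nocross (F.deleteEdges C) S (by
          intro x hx y hy ha
          obtain ⟨rfl, rfl⟩ := h x hx y ((hT y).2 hy) (SimpleGraph.deleteEdges_le _ ha)
          rw [SimpleGraph.deleteEdges_adj, Sym2.eq_swap] at ha
          exact ha.2 hc) hr
        exact (hT _).1 y.2 (this.1 x.2)
      · exact reach_out _ S u hu h1 x y x.2 ((hT _).1 y.2) hr
      · exact (reach_out _ T v hv h2 y x y.2 (fun h' => (hT _).1 h' x.2) hr.symm).symm
    · rintro ⟨hc, h3, h4⟩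
      refine h3.trans (SimpleGraph.Reachable.trans ?_ h4)
      apply SimpleGraph.Adj.reachable
      rw [SimpleGraph.deleteEdges_adj, Sym2.eq_swap]
      exact ⟨hadj.symm, hc⟩

theorem counts {V : Type} [Finite V] (F : SimpleGraph V) (S T : Set V) (hT : ∀ w, w ∈ T ↔ w ∉ S)
    (u v : V) (hu : u ∈ S) (hv : v ∈ T) (hadj : F.Adj v u)
    (h : ∀ x ∈ S, ∀ y ∈ T, F.Adj x y → x = u ∧ y = v) (b : ℕ) (C : Set (Sym2 V)) (lam : V → Fin b)
    (hlam : ∀ x y : V, (F.deleteEdges C).Reachable x y → lam x = lam y) (C1 : Set (Sym2 S))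
    (C2 : Set (Sym2 T)) (hC1 : C1 = Sym2.map (Subtype.val : S → V) ⁻¹' C)
    (hC2 : C2 = Sym2.map (Subtype.val : T → V) ⁻¹' C) [Decidable (s(v, u) ∈ C)] :
    {w | (F.deleteEdges C).Reachable v w}.ncard =
      (if s(v, u) ∈ C then 0 else {w | ((F.induce S).deleteEdges C1).Reachable ⟨u, hu⟩ w}.ncard)
      + {w | ((F.induce T).deleteEdges C2).Reachable ⟨v, hv⟩ w}.ncard ∧
    ∀ g, {w | lam w = g ∧ ¬ (F.deleteEdges C).Reachable v w}.ncard =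
      {w : S | lam w = g ∧ ¬ ((F.induce S).deleteEdges C1).Reachable ⟨u, hu⟩ w}.ncard +
      {w : T | lam w = g ∧ ¬ ((F.induce T).deleteEdges C2).Reachable ⟨v, hv⟩ w}.ncard +
      (if s(v, u) ∈ C ∧ g = lam u then
        {w | ((F.induce S).deleteEdges C1).Reachable ⟨u, hu⟩ w}.ncard else 0) := by
  subst hC1 hC2
  obtain ⟨r1, r2, r3⟩ := reach_all F S T hT u v hu hv hadj h C
  have r4 : ∀ w : S, (F.deleteEdges C).Reachable v w ↔
      s(v, u) ∉ C ∧ (F.deleteEdges C).Reachable u w := by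
    intro w
    rw [SimpleGraph.reachable_comm, r3 w ⟨v, hv⟩, SimpleGraph.reachable_comm (u := u)]
    simp
  constructor
  · rw [ncard_split S T hT]
    simp only [r1, r2, r4]
    congr 1
    split_ifs with hc <;> simp [hc]
  · intro g
    rw [ncard_split S T hT]
    simp only [r1, r2, r4]
    by_cases hc : s(v, u) ∈ C
    · simp only [hc, not_true_eq_false, false_and, not_false_eq_true, and_true, true_and]
      have e : {w : S | lam w = g}.ncard =
          {w : S | lam w = g ∧ ¬ (F.deleteEdges C).Reachable u w}.ncard +
          {w : S | lam w = g ∧ (F.deleteEdges C).Reachable u w}.ncard := by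
        rw [← Set.ncard_union_eq]
        · congr 1
          ext w
          simp only [Set.mem_ofPred_eq, Set.mem_union]
          tauto
        · rw [Set.disjoint_left]
          rintro w ⟨-, hw⟩ ⟨-, hw'⟩
          exact hw hw'
      have e2 : {w : S | lam w = g ∧ (F.deleteEdges C).Reachable u w}.ncard =
          if g = lam u then {w : S | (F.deleteEdges C).Reachable u w}.ncard else 0 := by
        split_ifs with hg
        · congr 1
          ext w
          simp only [Set.mem_ofPred_eq, and_iff_right_iff_imp]
          intro hw
          rw [hg, hlam _ _ hw]
        · rw [Set.ncard_eq_zero (Set.toFinite _)]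
          ext w
          simp only [Set.mem_ofPred_eq, Set.mem_empty_iff_false, iff_false]
          rintro ⟨h1, h2⟩
          exact hg (by rw [← h1, hlam _ _ h2])
      rw [e, e2]
      omega
    · simp [hc]

theorem core_fwd {V : Type} [Finite V] (F : SimpleGraph V) (S T : Set V) (hT : ∀ w, w ∈ T ↔ w ∉ S)
    (u v : V) (hu : u ∈ S) (hv : v ∈ T) (hadj : F.Adj v u)
    (h : ∀ x ∈ S, ∀ y ∈ T, F.Adj x y → x = u ∧ y = v) (b k s : ℕ) (n : Fin b → ℕ)
    (hR : RealF F v b k s none n) :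
    ∃ k1 k2 s1 s2 n1 n2, RealF (F.induce S) ⟨u, hu⟩ b k1 s1 none n1 ∧
      RealF (F.induce T) ⟨v, hv⟩ b k2 s2 none n2 ∧
      ((k1 + k2 + 1 = k ∧ s2 = s ∧ ∃ g, n1 + n2 + Pi.single g s1 = n) ∨
       (k1 + k2 = k ∧ s1 + s2 = s ∧ n1 + n2 = n)) := by
  classical
  obtain ⟨C, lam, h1, h2, h3, h4, h5, -⟩ := hR
  obtain ⟨r1, r2, r3⟩ := reach_all F S T hT u v hu hv hadj h C
  obtain ⟨c1, c2⟩ := counts F S T hT u v hu hv hadj h b C lam h4 _ _ rfl rfl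
  have ce := edge_split F S T hT u v hu hv h C h1
  refine ⟨_, _, _, _, _, _, ⟨Sym2.map (Subtype.val : S → V) ⁻¹' C, fun w => lam w, ?_, rfl, rfl, ?_,
    fun g => rfl, by simp⟩, ⟨Sym2.map (Subtype.val : T → V) ⁻¹' C, fun w => lam w, ?_, rfl, rfl, ?_,
    fun g => rfl, by simp⟩, ?_⟩
  · intro e he
    induction e with | _ x y => exact h1 he
  · intro x y hxy
    exact h4 _ _ ((r1 x y).1 hxy)
  · intro e he
    induction e with | _ x y => exact h1 he
  · intro x y hxy
    exact h4 _ _ ((r2 x y).1 hxy)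
  · by_cases hc : s(v, u) ∈ C
    · left
      have : C ∩ {s(v, u)} = {s(v, u)} := by simpa using hc
      rw [this, Set.ncard_singleton] at ce
      refine ⟨by omega, ?_, lam u, ?_⟩
      · rw [← h3, c1]; simp [hc]
      · funext g
        rw [← h5 g, c2 g]
        simp [hc, Pi.single_apply]
    · right
      have : C ∩ {s(v, u)} = ∅ := by simpa using hc
      rw [this, Set.ncard_empty] at ce
      refine ⟨by omega, ?_, ?_⟩
      · rw [← h3, c1]; simp [hc]
      · funext g
        rw [← h5 g, c2 g]
        simp [hc]

theorem core_bwd {V : Type} [Finite V] (F : SimpleGraph V) (S T : Set V) (hT : ∀ w, w ∈ T ↔ w ∉ S)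
    (u v : V) (hu : u ∈ S) (hv : v ∈ T) (hadj : F.Adj v u)
    (h : ∀ x ∈ S, ∀ y ∈ T, F.Adj x y → x = u ∧ y = v) (b k1 k2 s1 s2 : ℕ) (n1 n2 : Fin b → ℕ)
    (R1 : RealF (F.induce S) ⟨u, hu⟩ b k1 s1 none n1)
    (R2 : RealF (F.induce T) ⟨v, hv⟩ b k2 s2 none n2) (g0 : Fin b) :
    RealF F v b (k1 + k2 + 1) s2 none (n1 + n2 + Pi.single g0 s1) ∧
    RealF F v b (k1 + k2) (s1 + s2) none (n1 + n2) := by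
  classical
  obtain ⟨C1, lam1, a1, a2, a3, a4, a5, a6⟩ := R1.normalize g0
  obtain ⟨C2, lam2, b1, b2, b3, b4, b5, b6⟩ := R2.normalize g0
  have a6 := a6 g0 rfl
  have b6 := b6 g0 rfl
  let lam : V → Fin b := fun w => if hw : w ∈ S then lam1 ⟨w, hw⟩ else lam2 ⟨w, (hT w).2 hw⟩
  have l1 : ∀ w : S, lam w = lam1 w := by intro w; simp [lam]
  have l2 : ∀ w : T, lam w = lam2 w := by
    intro w
    have := (hT _).1 w.2
    simp [lam, this]
  have key : ∀ D : Set (Sym2 V), D ⊆ {s(v, u)} →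
      let C := (Sym2.map (Subtype.val : S → V) '' C1) ∪ (Sym2.map (Subtype.val : T → V) '' C2) ∪ D
      C ⊆ F.edgeSet ∧ C1 = Sym2.map (Subtype.val : S → V) ⁻¹' C ∧
        C2 = Sym2.map (Subtype.val : T → V) ⁻¹' C ∧ C ∩ {s(v, u)} = D ∧
        (∀ x y : V, (F.deleteEdges C).Reachable x y → lam x = lam y) := by
    intro D hD C
    have hvS := (hT v).1 hv
    have d1 : ∀ e : Sym2 S, ∀ f : Sym2 T, Sym2.map Subtype.val e ≠ Sym2.map Subtype.val f := by
      intro e f hf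
      induction e with | _ x y => ?_
      induction f with | _ a c => ?_
      have hx := (hT _).1 a.2
      have hx := (hT _).1 c.2
      have := x.2
      have := y.2
      simp at hf
      grind
    have d2 : ∀ e : Sym2 S, Sym2.map Subtype.val e ≠ s(v, u) := by
      intro e hf
      induction e with | _ x y => ?_
      have := x.2
      have := y.2
      simp at hf
      grind
    have d3 : ∀ e : Sym2 T, Sym2.map Subtype.val e ≠ s(v, u) := by
      intro e hf
      induction e with | _ x y => ?_
      have := (hT _).1 x.2
      have := (hT _).1 y.2
      simp at hf
      grind
    have q1 : C1 = Sym2.map (Subtype.val : S → V) ⁻¹' C := by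
      ext e
      constructor
      · intro he
        exact Or.inl (Or.inl ⟨e, he, rfl⟩)
      · rintro ((⟨f, hf, he⟩ | ⟨f, hf, he⟩) | he)
        · rwa [← Sym2.map.injective Subtype.val_injective he]
        · exact absurd he.symm (d1 _ _)
        · exact absurd (hD he) (d2 _)
    have q2 : C2 = Sym2.map (Subtype.val : T → V) ⁻¹' C := by
      ext e
      constructor
      · intro he
        exact Or.inl (Or.inr ⟨e, he, rfl⟩)
      · rintro ((⟨f, hf, he⟩ | ⟨f, hf, he⟩) | he)
        · exact absurd he (d1 _ _)
        · rwa [← Sym2.map.injective Subtype.val_injective he]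
        · exact absurd (hD he) (d3 _)
    refine ⟨?_, q1, q2, ?_, ?_⟩
    · rintro _ ((⟨f, hf, rfl⟩ | ⟨f, hf, rfl⟩) | he)
      · have := a1 hf
        induction f with | _ x y => exact this
      · have := b1 hf
        induction f with | _ x y => exact this
      · rw [hD he]; exact hadj
    · ext e
      constructor
      · rintro ⟨(⟨f, hf, rfl⟩ | ⟨f, hf, rfl⟩) | he, hu⟩
        · exact absurd hu (d2 _)
        · exact absurd hu (d3 _)
        · exact he
      · intro he
        exact ⟨Or.inr he, hD he⟩
    · obtain ⟨r1, r2, r3⟩ := reach_all F S T hT u v hu hv hadj h C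
      rw [← q1] at r1
      rw [← q2] at r2
      have cross : ∀ (x : S) (y : T), (F.deleteEdges C).Reachable x y → lam x = lam y := by
        intro x y hxy
        obtain ⟨-, hx, hy⟩ := (r3 x y).1 hxy
        rw [l1, l2, a4 x ⟨u, hu⟩ ((r1 _ _).2 hx), ← b4 ⟨v, hv⟩ y ((r2 _ _).2 hy), a6, b6]
      intro x y hxy
      by_cases hx : x ∈ S <;> by_cases hy : y ∈ S
      · exact (l1 ⟨x, hx⟩).trans ((a4 _ _ ((r1 ⟨x, hx⟩ ⟨y, hy⟩).2 hxy)).trans (l1 ⟨y, hy⟩).symm)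
      · exact cross ⟨x, hx⟩ ⟨y, (hT y).2 hy⟩ hxy
      · exact (cross ⟨y, hy⟩ ⟨x, (hT x).2 hx⟩ hxy.symm).symm
      · exact (l2 ⟨x, (hT x).2 hx⟩).trans ((b4 _ _ ((r2 ⟨x, (hT x).2 hx⟩ ⟨y, (hT y).2 hy⟩).2 hxy)).trans
          (l2 ⟨y, (hT y).2 hy⟩).symm)
  have lu : lam u = g0 := (l1 ⟨u, hu⟩).trans a6
  constructor
  · obtain ⟨k1, k2, k3, k4, k5⟩ := key {s(v, u)} subset_rfl
    generalize (Sym2.map (Subtype.val : S → V) '' C1) ∪ (Sym2.map (Subtype.val : T → V) '' C2) ∪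
      {s(v, u)} = C at k1 k2 k3 k4 k5
    have hc : s(v, u) ∈ C := by
      have : s(v, u) ∈ C ∩ {s(v, u)} := by rw [k4]; rfl
      exact this.1
    obtain ⟨c1, c2⟩ := counts F S T hT u v hu hv hadj h b C lam k5 _ _ k2 k3
    have ce := edge_split F S T hT u v hu hv h C k1
    rw [← k2, ← k3, k4, Set.ncard_singleton, a2, b2] at ce
    refine ⟨C, lam, k1, ce, ?_, k5, ?_, by simp⟩
    · rw [c1, b3]; simp [hc]
    · intro g
      rw [c2]
      simp only [l1, l2, a5, b5, a3, hc, lu]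
      simp [Pi.single_apply]
  · obtain ⟨k1, k2, k3, k4, k5⟩ := key ∅ (by simp)
    generalize (Sym2.map (Subtype.val : S → V) '' C1) ∪ (Sym2.map (Subtype.val : T → V) '' C2) ∪
      ∅ = C at k1 k2 k3 k4 k5
    have hc : s(v, u) ∉ C := by
      intro hc
      have : s(v, u) ∈ C ∩ {s(v, u)} := ⟨hc, rfl⟩
      rw [k4] at this
      exact this
    obtain ⟨c1, c2⟩ := counts F S T hT u v hu hv hadj h b C lam k5 _ _ k2 k3
    have ce := edge_split F S T hT u v hu hv h C k1
    rw [← k2, ← k3, k4, Set.ncard_empty, a2, b2] at ce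
    refine ⟨C, lam, k1, ce, ?_, k5, ?_, by simp⟩
    · rw [c1, b3, a3]; simp [hc]
    · intro g
      rw [c2]
      simp only [l1, l2, a5, b5, a3, hc, lu]
      simp

/-- The recurrence behind the dynamic programming over the tree: let `F` be a finite tree
rooted at `v`, let `u` be a child of `v`, let `F_u` be the subtree of `F` rooted at `u`
(the component of `u` in `F` minus the edge `uv`), and let `F⁻` be `F` minus the vertices of
`F_u`, rooted at `v`. Then `(k', X, s)` is realizable in `F` iff either (i) the edge `uv` is
cut: for some `k₁ + k₂ + 1 = k'`, some `(k₁, Y, s₁)` realizable in `F_u`, some `(k₂, Z, s)`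
realizable in `F⁻`, and some `j ∈ X` with `j ≥ s₁`, we have `X' = Y ◇ Z` where `X'` replaces
one occurrence of `j` in `X` by `j − s₁`; or (ii) the edge `uv` is not cut: for some
`k₁ + k₂ = k'`, `s₁ + s₂ = s`, `(k₁, Y, s₁)` realizable in `F_u` and `(k₂, Z, s₂)` realizable
in `F⁻` with `X = Y ◇ Z`. -/
theorem statement18
    (V : Type) [Fintype V] (F : SimpleGraph V) (hF : F.IsTree)
    (v u : V) (hu : F.Adj v u)
    (hsep : ¬ (F.deleteEdges {s(v, u)}).Reachable u v)
    (b : ℕ) (hb : 1 ≤ b) (k' s : ℕ) (X : Multiset ℕ) (hX : Multiset.card X = b) :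
    Realizable F v b k' s X ↔
      ((∃ k₁ k₂ : ℕ, k₁ + k₂ + 1 = k' ∧ ∃ s₁ : ℕ, ∃ Y Z : Multiset ℕ,
          Multiset.card Y = b ∧ Multiset.card Z = b ∧
          ∃ j ∈ X, s₁ ≤ j ∧
          Realizable (F.induce {w | (F.deleteEdges {s(v, u)}).Reachable u w})
            ⟨u, SimpleGraph.Reachable.refl u⟩ b k₁ s₁ Y ∧
          Realizable (F.induce {w | ¬ (F.deleteEdges {s(v, u)}).Reachable u w})
            ⟨v, hsep⟩ b k₂ s Z ∧
          DiamondEq ((j - s₁) ::ₘ X.erase j) Y Z) ∨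
       (∃ k₁ k₂ : ℕ, k₁ + k₂ = k' ∧ ∃ s₁ s₂ : ℕ, s₁ + s₂ = s ∧ ∃ Y Z : Multiset ℕ,
          Multiset.card Y = b ∧ Multiset.card Z = b ∧
          Realizable (F.induce {w | (F.deleteEdges {s(v, u)}).Reachable u w})
            ⟨u, SimpleGraph.Reachable.refl u⟩ b k₁ s₁ Y ∧
          Realizable (F.induce {w | ¬ (F.deleteEdges {s(v, u)}).Reachable u w})
            ⟨v, hsep⟩ b k₂ s₂ Z ∧
          DiamondEq X Y Z)) := by
  have hcross : ∀ x ∈ {w | (F.deleteEdges {s(v, u)}).Reachable u w},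
      ∀ y ∈ {w | ¬ (F.deleteEdges {s(v, u)}).Reachable u w}, F.Adj x y → x = u ∧ y = v := by
    intro x hx y hy ha
    by_cases he : s(x, y) = s(v, u)
    · rcases Sym2.eq_iff.1 he with ⟨rfl, rfl⟩ | ⟨rfl, rfl⟩
      · exact absurd hx hsep
      · exact ⟨rfl, rfl⟩
    · exfalso
      apply hy
      refine SimpleGraph.Reachable.trans hx (SimpleGraph.Adj.reachable ?_)
      rw [SimpleGraph.deleteEdges_adj]
      exact ⟨ha, he⟩
  have hT : ∀ w, w ∈ {w | ¬ (F.deleteEdges {s(v, u)}).Reachable u w} ↔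
      w ∉ {w | (F.deleteEdges {s(v, u)}).Reachable u w} := fun w => Iff.rfl
  constructor
  · intro hR
    obtain ⟨n, hn, rfl⟩ := (realizable_iff ..).1 hR
    obtain ⟨k1, k2, s1, s2, n1, n2, R1, R2, hor⟩ :=
      core_fwd F _ _ hT u v (SimpleGraph.Reachable.refl u) hsep hu hcross b k' s n hn
    have R1' := (realizable_iff ..).2 ⟨n1, R1, rfl⟩
    have R2' := (realizable_iff ..).2 ⟨n2, R2, rfl⟩
    rcases hor with ⟨hk, rfl, g, rfl⟩ | ⟨hk, hs, rfl⟩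
    · left
      obtain ⟨j, hj, hs, he⟩ := (replace_iff (n1 + n2) _ s1).2 ⟨g, rfl⟩
      exact ⟨k1, k2, hk, s1, _, _, by simp, by simp, j, hj, hs, R1', R2',
        (diamond_iff b _ _ _ (by simp) (by simp)).2 ⟨n1, n2, rfl, rfl, he⟩⟩
    · right
      exact ⟨k1, k2, hk, s1, s2, hs, _, _, by simp, by simp, R1', R2',
        (diamond_iff b _ _ _ (by simp) (by simp)).2 ⟨n1, n2, rfl, rfl, rfl⟩⟩
  · rintro (⟨k1, k2, rfl, s1, Y, Z, hY, hZ, j, hj, hs, R1, R2, hD⟩ |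
      ⟨k1, k2, rfl, s1, s2, rfl, Y, Z, hY, hZ, R1, R2, hD⟩)
    · obtain ⟨n1, n2, rfl, rfl, he⟩ := (diamond_iff b _ _ _ hY hZ).1 hD
      obtain ⟨g, hg⟩ := (replace_iff (n1 + n2) X s1).1 ⟨j, hj, hs, he⟩
      exact (realizable_iff ..).2 ⟨_, (core_bwd F _ _ hT u v (SimpleGraph.Reachable.refl u) hsep hu
        hcross b k1 k2 s1 s n1 n2 (realF_of_map R1) (realF_of_map R2) g).1, hg⟩
    · obtain ⟨n1, n2, rfl, rfl, he⟩ := (diamond_iff b _ _ _ hY hZ).1 hD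
      exact (realizable_iff ..).2 ⟨_, (core_bwd F _ _ hT u v (SimpleGraph.Reachable.refl u) hsep hu
        hcross b k1 k2 s1 s2 n1 n2 (realF_of_map R1) (realF_of_map R2) ⟨0, hb⟩).2, he⟩
end
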